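/- Let p be a prime and let N(1) denote the number of 1s in a period of the sequence (s_n). Then N(1) = (1/(2 - φ(p-1)/p) + o(1))·T as p → ∞ through the primes; that is, for every ε > 0 there exists P such that for all primes p ≥ P, |N(1) - T/(2 - φ(p-1)/p)| ≤ ε·T. -/

import Mathlib

/-- The primitive roots modulo `p` in increasing order: `g_1 < g_2 < … < g_{φ(p-1)}`
(0-indexed as a sorted list). -/
noncomputable def primRootsList (p : ℕ) : List ℕ :=
  ((Finset.Ico 1 p).filter fun g : ℕ => orderOf ((g : ZMod p)) = p - 1).sort (· ≤ ·)

/-- The binary sequence `s_n ≡ g_{n+1} + g_{n+2} (mod 2)` of period `T = φ(p-1) - 1`,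
extended `T`-periodically. -/
noncomputable def seqS (p n : ℕ) : ℕ :=
  ((primRootsList p).getD (n % (Nat.totient (p - 1) - 1)) 0 +
    (primRootsList p).getD (n % (Nat.totient (p - 1) - 1) + 1) 0) % 2

open Polynomial in
theorem Matrix.natDegree_det_le_sum {R : Type*} [CommRing R] {n : Type*} [Fintype n] [DecidableEq n]
    (M : Matrix n n R[X]) (c : n → ℕ) (h : ∀ i j, (M i j).natDegree ≤ c j) :
    M.det.natDegree ≤ ∑ j, c j := by
  rw [Matrix.det_apply]
  refine (natDegree_sum_le_of_forall_le _ _ fun σ _ => ?_)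
  refine (natDegree_smul_le _ _).trans ?_
  exact (natDegree_prod_le _ _).trans (Finset.sum_le_sum fun i _ => h _ _)

open Polynomial in
theorem Polynomial.natDegree_resultant_le {R : Type*} [CommRing R] (f g : R[X][X]) (m n a b : ℕ)
    (hf : ∀ i, (f.coeff i).natDegree ≤ a) (hg : ∀ i, (g.coeff i).natDegree ≤ b) :
    (resultant f g m n).natDegree ≤ m * b + n * a := by
  refine (Matrix.natDegree_det_le_sum _
    (fun j => Fin.addCases (fun _ => b) (fun _ => a) j) ?_).trans ?_
  · intro i j
    induction j using Fin.addCases <;> simp only [sylvester, Matrix.of_apply, Fin.addCases_left,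
      Fin.addCases_right] <;> split_ifs <;> simp [hf, hg]
  · simp [Fin.sum_univ_add]

open Polynomial in
/-- A binomial of squarefree degree is irreducible as soon as its constant is not a prime power
of an element, for the primes dividing the degree. -/
theorem X_pow_sub_C_irreducible_of_squarefree {K : Type*} [Field K] {d : ℕ} (hd : Squarefree d)
    {a : K} (ha : ∀ l : ℕ, l.Prime → l ∣ d → ∀ b : K, b ^ l ≠ a) :
    Irreducible (X ^ d - C a : K[X]) := by
  have hd0 : d ≠ 0 := hd.ne_zero
  have hdeg : (X ^ d - C a : K[X]).natDegree = d := natDegree_X_pow_sub_C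
  obtain ⟨α, hα⟩ := IsAlgClosed.exists_pow_nat_eq (algebraMap K (AlgebraicClosure K) a)
    (Nat.pos_of_ne_zero hd0)
  have hα_int : IsIntegral K α := Algebra.IsIntegral.isIntegral α
  have hroot : aeval α (X ^ d - C a : K[X]) = 0 := by simp [hα]
  have hdvd : minpoly K α ∣ X ^ d - C a := minpoly.dvd K α hroot
  have hmonic : (X ^ d - C a : K[X]).Monic := monic_X_pow_sub_C a hd0
  have hl : ∀ l : ℕ, l.Prime → l ∣ d → l ∣ (minpoly K α).natDegree := by
    intro l hl hld
    obtain ⟨e, he⟩ := hld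
    have hirr := X_pow_sub_C_irreducible_of_prime hl (ha l hl ⟨e, he⟩)
    have hmin : X ^ l - C a = minpoly K (α ^ e) :=
      minpoly.eq_of_irreducible_of_monic hirr
        (by simp [← pow_mul, mul_comm e l, ← he, hα]) (monic_X_pow_sub_C a hl.ne_zero)
    have : (minpoly K (α ^ e)).natDegree ∣ (minpoly K α).natDegree := by
      rw [← IntermediateField.adjoin.finrank hα_int]
      have h := minpoly.degree_dvd (K := K)
        (x := (IntermediateField.AdjoinSimple.gen K α) ^ e)
        (((IntermediateField.AdjoinSimple.isIntegral_gen K α).2 hα_int).pow e)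
      rwa [← minpoly.algebraMap_eq (algebraMap (IntermediateField.adjoin K {α})
        (AlgebraicClosure K)).injective, map_pow,
        IntermediateField.AdjoinSimple.algebraMap_gen] at h
    rwa [← hmin, natDegree_X_pow_sub_C] at this
  have hdd : d ∣ (minpoly K α).natDegree := by
    rw [← Nat.prod_primeFactors_of_squarefree hd]
    refine Finset.prod_primes_dvd _ (fun l hl' => (Nat.prime_of_mem_primeFactors hl').prime)
      fun l hl' => hl l (Nat.prime_of_mem_primeFactors hl') (Nat.dvd_of_mem_primeFactors hl')
  have hpos : 0 < (minpoly K α).natDegree := minpoly.natDegree_pos hα_int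
  have : minpoly K α = X ^ d - C a :=
    (eq_of_monic_of_dvd_of_natDegree_le (minpoly.monic hα_int) hmonic hdvd
      (by rw [hdeg]; exact Nat.le_of_dvd hpos hdd)).symm
  rw [← this]
  exact minpoly.irreducible hα_int

open Polynomial Finset in
/-- The nonvanishing step of Stepanov's method. -/
theorem stepanov_nonvanishing {p : ℕ} [Fact p.Prime] {d m : ℕ} (hdm : m * d = p - 1)
    (hd : Squarefree d) {f : (ZMod p)[X]}
    (hf : ∀ l : ℕ, l.Prime → l ∣ d → ∃ c, ¬ l ∣ f.rootMultiplicity c)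
    {c : ZMod p} (hc : f.eval c ≠ 0) {A : ℕ} {P : ℕ → (ZMod p)[X]}
    (hP : ∀ b < d, (P b).natDegree ≤ A) (hdeg : d * (A + f.natDegree) < p)
    (hdvd : (X - C c) ^ p ∣ ∑ b ∈ range d, P b * f ^ (m * b)) : ∀ b < d, P b = 0 := by
  have hp : p.Prime := Fact.out
  have hd0 : d ≠ 0 := hd.ne_zero
  have hf0 : f ≠ 0 := by rintro rfl; simp at hc
  set Q : (ZMod p)[X][X] := ∑ b ∈ range d, C (P b) * X ^ b with hQ
  set R : (ZMod p)[X][X] := C f * X ^ d - C (C (f.eval c)) with hR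
  have hQcoeff : ∀ i, Q.coeff i = if i < d then P i else 0 := by
    intro i
    simp [hQ, finsetSum_coeff, coeff_X_pow]
  by_contra! hne
  obtain ⟨b₀, hb₀, hPb₀⟩ := hne
  have hQ0 : Q ≠ 0 := by
    intro h
    apply hPb₀
    have := hQcoeff b₀
    rw [h] at this
    simpa [hb₀] using this.symm
  have hQdeg : Q.natDegree < d := by
    rw [natDegree_lt_iff_degree_lt hQ0, degree_lt_iff_coeff_zero]
    intro i hi
    rw [hQcoeff, if_neg (by omega)]
  have hRdeg : R.natDegree = d := by
    rw [hR, natDegree_sub_C, natDegree_C_mul_X_pow _ _ hf0]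
  set K := FractionRing (ZMod p)[X]
  have hinj : Function.Injective (algebraMap (ZMod p)[X] K) := IsFractionRing.injective _ _
  have hfK : algebraMap (ZMod p)[X] K f ≠ 0 := by
    rwa [Ne, map_eq_zero_iff _ hinj]
  set a : K := algebraMap _ K (C (f.eval c)) / algebraMap _ K f with ha
  have hRmap : R.map (algebraMap _ K) = C (algebraMap _ K f) * (X ^ d - C a) := by
    simp only [hR, Polynomial.map_sub, Polynomial.map_mul, map_C, Polynomial.map_pow, map_X,
      mul_sub, ← C_mul]
    rw [ha, mul_div_cancel₀ _ hfK]
  have hirr : Irreducible (X ^ d - C a : K[X]) := by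
    refine X_pow_sub_C_irreducible_of_squarefree hd fun l hl hld b hb => ?_
    obtain ⟨x, hx⟩ := hf l hl hld
    apply hx
    obtain ⟨u, v, hv, rfl⟩ := IsFractionRing.div_surjective (A := (ZMod p)[X]) b
    have hv0 : v ≠ 0 := nonZeroDivisors.ne_zero hv
    have hvK : algebraMap (ZMod p)[X] K v ≠ 0 := by
      rwa [Ne, map_eq_zero_iff _ hinj]
    rw [ha, div_pow, div_eq_div_iff (pow_ne_zero _ hvK) hfK, ← map_pow, ← map_pow, ← map_mul,
      ← map_mul] at hb
    have hb := hinj hb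
    have hne : C (f.eval c) * v ^ l ≠ 0 := mul_ne_zero (by simpa using hc) (pow_ne_zero _ hv0)
    have h1 := congrArg (rootMultiplicity x) hb
    rw [rootMultiplicity_mul (hb ▸ hne), rootMultiplicity_mul hne, ← count_roots, ← count_roots,
      ← count_roots, ← count_roots, roots_pow, roots_pow, Multiset.count_nsmul,
      Multiset.count_nsmul, count_roots, count_roots, count_roots, count_roots, rootMultiplicity_C,
        zero_add] at h1
    exact (Nat.dvd_add_right (Dvd.intro _ rfl)).1 (h1 ▸ Dvd.intro _ rfl)
  have hcop : IsCoprime (Q.map (algebraMap _ K)) (R.map (algebraMap _ K)) := by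
    rw [hRmap, isCoprime_mul_unit_left_right (isUnit_C.2 (isUnit_iff_ne_zero.2 hfK)),
      isCoprime_comm,
      hirr.coprime_iff_not_dvd]
    intro h
    have := natDegree_le_of_dvd h (by rwa [Ne, Polynomial.map_eq_zero_iff hinj])
    rw [natDegree_X_pow_sub_C, natDegree_map_eq_of_injective hinj] at this
    omega
  have hres : resultant Q R ≠ 0 := by
    intro h
    have h1 := resultant_map_map Q R Q.natDegree R.natDegree (algebraMap (ZMod p)[X] K)
    rw [h, map_zero] at h1
    have h2 : resultant (Q.map (algebraMap _ K)) (R.map (algebraMap _ K)) = 0 := by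
      rw [natDegree_map_eq_of_injective hinj, natDegree_map_eq_of_injective hinj]
      exact h1
    exact (resultant_eq_zero_iff.1 h2).2 hcop
  have hresdeg : (resultant Q R).natDegree < p := by
    refine (natDegree_resultant_le Q R _ _ A f.natDegree ?_ ?_).trans_lt ?_
    · intro i
      rw [hQcoeff]
      split_ifs with h
      · exact hP i h
      · simp
    · intro i
      rw [hR, coeff_sub, coeff_C_mul, coeff_X_pow, coeff_C]
      refine (natDegree_sub_le _ _).trans ?_
      split_ifs <;> simp
    · rw [hRdeg]
      nlinarith [Nat.zero_le f.natDegree]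
  obtain ⟨u, v, -, -, huv⟩ := exists_mul_add_mul_eq_C_resultant Q R le_rfl le_rfl
    (Or.inr (by rw [hRdeg]; exact hd0))
  have hev := congrArg (eval (f ^ m)) huv
  rw [eval_C, eval_add, eval_mul, eval_mul] at hev
  have hQe : (X - C c) ^ p ∣ Q.eval (f ^ m) := by
    simpa [hQ, eval_finsetSum, ← pow_mul] using hdvd
  have hRe : (X - C c) ^ p ∣ R.eval (f ^ m) := by
    have h1 : R.eval (f ^ m) = f ^ p - C (f.eval c) := by
      simp only [hR, eval_sub, eval_mul, eval_C, eval_pow, eval_X, ← pow_mul, hdm]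
      rw [← pow_succ', Nat.sub_add_cancel hp.one_le]
    have h2 : f ^ p - C (f.eval c) = (f - C (f.eval c)) ^ p := by
      rw [sub_pow_char, ← C_pow, ZMod.pow_card]
    rw [h1, h2]
    refine pow_dvd_pow_of_dvd ?_ _
    rw [dvd_iff_isRoot]
    simp
  have hdv : (X - C c) ^ p ∣ resultant Q R := by
    rw [← hev]
    exact dvd_add (hQe.mul_right _) (hRe.mul_right _)
  have := natDegree_le_of_dvd hdv hres
  rw [natDegree_pow, natDegree_X_sub_C] at this
  omega

open Polynomial in
/-- If the iterates of `g * d/dX` on `Ψ` vanish at `x` up to order `M`, where `g x ≠ 0`, then `Ψ`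
vanishes to order `M` at `x`. -/
theorem pow_dvd_of_iterate_derivative_eval_eq_zero {p : ℕ} [Fact p.Prime] {g : (ZMod p)[X]}
    {x : ZMod p} (hg : g.eval x ≠ 0) {M : ℕ} (hM : M ≤ p) {Ψ : (ZMod p)[X]}
    (h : ∀ r < M, ((fun Φ : (ZMod p)[X] => g * derivative Φ)^[r] Ψ).eval x = 0) :
    (X - C x) ^ M ∣ Ψ := by
  induction M generalizing Ψ with
  | zero => simp
  | succ M ih =>
    have h0 : Ψ.eval x = 0 := h 0 (Nat.succ_pos _)
    have h1 : (X - C x) ^ M ∣ Ψ := ih (by omega) fun r hr => h r (by omega)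
    have h2 : (X - C x) ^ M ∣ g * derivative Ψ := by
      refine ih (by omega) fun r hr => ?_
      have := h (r + 1) (by omega)
      rwa [Function.iterate_succ_apply] at this
    obtain rfl | hM0 := Nat.eq_zero_or_pos M
    · rw [zero_add, pow_one, dvd_iff_isRoot]
      exact h0
    have h3 : (X - C x) ^ M ∣ derivative Ψ := by
      refine (IsCoprime.pow_left ?_).dvd_of_dvd_mul_left h2
      rw [(irreducible_X_sub_C x).coprime_iff_not_dvd, dvd_iff_isRoot]
      exact hg
    obtain ⟨U, rfl⟩ := h1
    have h4 : (X - C x) ^ M ∣ (X - C x) ^ (M - 1) * (C (M : ZMod p) * U) := by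
      rw [derivative_mul, derivative_X_sub_C_pow] at h3
      have := (dvd_add_left (Dvd.intro (derivative U) rfl)).1 h3
      simpa [mul_assoc, mul_comm, mul_left_comm] using this
    have h5 : (X - C x) ∣ C (M : ZMod p) * U := by
      rw [show (X - C x) ^ M = (X - C x) ^ (M - 1) * (X - C x) by
        rw [← pow_succ, Nat.sub_add_cancel hM0]] at h4
      exact (mul_dvd_mul_iff_left (pow_ne_zero _ (X_sub_C_ne_zero x))).1 h4
    have h6 : (M : ZMod p) ≠ 0 := by
      rw [Ne, ZMod.natCast_eq_zero_iff]
      exact fun hd => absurd (Nat.le_of_dvd hM0 hd) (by omega)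
    rw [pow_succ]
    refine mul_dvd_mul_left _ ?_
    rw [dvd_iff_isRoot, IsRoot, eval_mul, eval_C, mul_eq_zero] at h5
    rw [dvd_iff_isRoot]
    exact h5.resolve_left h6

open Polynomial Finset in
theorem stepanov_sum_ne_zero {p : ℕ} [Fact p.Prime] {d m B A : ℕ} (hdm : m * d = p - 1)
    (hd : Squarefree d) {f : (ZMod p)[X]}
    (hf : ∀ l : ℕ, l.Prime → l ∣ d → ∃ c, ¬ l ∣ f.rootMultiplicity c)
    {c : ZMod p} (hc : f.eval c ≠ 0) (hdeg : d * (A + f.natDegree) < p)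
    {P : ℕ → ℕ → (ZMod p)[X]} (hP : ∀ j < B, ∀ b < d, (P j b).natDegree ≤ A)
    (hne : ∃ j < B, ∃ b < d, P j b ≠ 0) :
    ∑ j ∈ range B, ∑ b ∈ range d, P j b * (X - C c) ^ (p * j) * f ^ (m * b) ≠ 0 := by
  classical
  intro hsum
  obtain ⟨hjB, b₁, hb₁, hPb₁⟩ := Nat.find_spec hne
  have hmin : ∀ j < Nat.find hne, ∀ b < d, P j b = 0 := by
    intro j hj b hb
    by_contra h
    exact Nat.find_min hne hj ⟨hj.trans hjB, b, hb, h⟩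
  revert hjB hPb₁ hmin
  generalize Nat.find hne = j₀
  intro hjB hPb₁ hmin
  apply hPb₁
  refine stepanov_nonvanishing hdm hd hf hc (hP j₀ hjB) hdeg ?_ b₁ hb₁
  have h1 : ∀ j, ∑ b ∈ range d, P j b * (X - C c) ^ (p * j) * f ^ (m * b) =
      (X - C c) ^ (p * j) * ∑ b ∈ range d, P j b * f ^ (m * b) := by
    intro j
    rw [mul_sum]
    exact sum_congr rfl fun b _ => by ring
  simp only [h1] at hsum
  have h2 : (X - C c) ^ (p * j₀) * (X - C c) ^ p ∣
      (X - C c) ^ (p * j₀) * ∑ b ∈ range d, P j₀ b * f ^ (m * b) := by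
    rw [← Finset.add_sum_erase _ _ (mem_range.2 hjB)] at hsum
    rw [eq_neg_of_add_eq_zero_left hsum, dvd_neg]
    refine dvd_sum fun j hj => ?_
    obtain ⟨hne, hj⟩ := mem_erase.1 hj
    obtain hlt | hlt := lt_or_gt_of_ne hne
    · rw [sum_eq_zero fun b hb => by rw [hmin j hlt b (mem_range.1 hb), zero_mul], mul_zero]
      exact dvd_zero _
    · rw [← pow_add]
      refine (pow_dvd_pow _ ?_).mul_right _
      nlinarith
  exact (mul_dvd_mul_iff_left (pow_ne_zero _ (X_sub_C_ne_zero c))).1 h2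

open Polynomial Finset in
/-- Stepanov's bound for the number of `x` with `f x ^ m = ζ`. -/
theorem stepanov_card_le {p : ℕ} [Fact p.Prime] {d m A B M κ : ℕ} (hdm : m * d = p - 1)
    (hd : Squarefree d) {f g h : (ZMod p)[X]}
    (hf : ∀ l : ℕ, l.Prime → l ∣ d → ∃ c, ¬ l ∣ f.rootMultiplicity c)
    (hfgh : g * derivative f = h * f) (hgf : ∀ x, f.eval x ≠ 0 → g.eval x ≠ 0)
    (hgdeg : g.natDegree ≤ κ + 1) (hhdeg : h.natDegree ≤ κ)
    (hdeg : d * (A + f.natDegree) < p) (hA : 0 < A) (hMp : M ≤ p)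
    (hM : M * (A + B + M * κ) < d * B * A) {ζ : ZMod p} (hζ : ζ ≠ 0) :
    #{x : ZMod p | f.eval x ^ m = ζ} * M ≤ p * (B + f.natDegree) := by
  classical
  have hp : p.Prime := Fact.out
  have hm0 : m ≠ 0 := by
    rintro rfl
    have := hp.two_le
    omega
  obtain hempty | ⟨c, hcmem⟩ :=
    (univ.filter fun x : ZMod p => f.eval x ^ m = ζ).eq_empty_or_nonempty
  · rw [hempty]; simp
  have hev : ∀ x, f.eval x ^ m = ζ → f.eval x ≠ 0 := by
    rintro x hx h0
    rw [h0, zero_pow hm0] at hx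
    exact hζ hx.symm
  have hc : f.eval c ≠ 0 := hev c (mem_filter.1 hcmem).2
  let L : ℕ → Module.End (ZMod p) (ZMod p)[X] := fun b =>
    LinearMap.mulLeft (ZMod p) g ∘ₗ derivative +
      LinearMap.mulLeft (ZMod p) (C ((m * b : ℕ) : ZMod p) * h)
  have hL : ∀ b P, L b P = g * derivative P + C ((m * b : ℕ) : ZMod p) * h * P := fun b P => rfl
  have hLdeg : ∀ b r P, ((L b ^ r) P).natDegree ≤ P.natDegree + r * κ := by
    intro b r P
    induction r with
    | zero => simp
    | succ r ih =>
      rw [pow_succ', Module.End.mul_apply, hL]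
      refine (natDegree_add_le _ _).trans (max_le ?_ ?_)
      · by_cases h0 : ((L b ^ r) P).natDegree = 0
        · rw [derivative_of_natDegree_zero h0]; simp
        · refine natDegree_mul_le.trans ?_
          have := natDegree_derivative_lt h0
          rw [add_mul, one_mul]
          omega
      · refine natDegree_mul_le.trans ?_
        have := natDegree_C_mul_le ((m * b : ℕ) : ZMod p) h
        rw [add_mul, one_mul]
        omega
  let T : ℕ → (Fin B × Fin d → degreeLT (ZMod p) A) →ₗ[ZMod p] (ZMod p)[X] := fun r =>
    ∑ q : Fin B × Fin d, LinearMap.mulLeft (ZMod p) (C (ζ ^ (q.2 : ℕ)) * (X - C c) ^ (q.1 : ℕ)) ∘ₗ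
      (L q.2 ^ r) ∘ₗ (degreeLT (ZMod p) A).subtype ∘ₗ LinearMap.proj q
  have hT : ∀ r v, T r v = ∑ q : Fin B × Fin d,
      C (ζ ^ (q.2 : ℕ)) * (X - C c) ^ (q.1 : ℕ) * (L q.2 ^ r) (v q : (ZMod p)[X]) := by
    intro r v
    simp [T, mul_assoc]
  have hvdeg : ∀ P : degreeLT (ZMod p) A, (P : (ZMod p)[X]).natDegree < A := by
    intro P
    by_cases h0 : (P : (ZMod p)[X]) = 0
    · rw [h0]; simpa
    · exact (natDegree_lt_iff_degree_lt h0).2 (mem_degreeLT.1 P.2)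
  have hTdeg : ∀ r < M, ∀ v, (T r v).natDegree < A + B + M * κ := by
    intro r hr v
    have : (T r v).natDegree ≤ A - 1 + B + M * κ := by
      rw [hT]
      refine natDegree_sum_le_of_forall_le _ _ fun q _ => ?_
      refine natDegree_mul_le.trans ?_
      have h1 := hLdeg q.2 r (v q)
      have h2 := hvdeg (v q)
      have h3 : (C (ζ ^ (q.2 : ℕ)) * (X - C c) ^ (q.1 : ℕ)).natDegree ≤ B := by
        refine (natDegree_C_mul_le _ _).trans ?_
        rw [natDegree_pow, natDegree_X_sub_C, mul_one]
        exact q.1.2.le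
      have h4 : r * κ ≤ M * κ := Nat.mul_le_mul_right _ hr.le
      omega
    omega
  let Λ : (Fin B × Fin d → degreeLT (ZMod p) A) →ₗ[ZMod p]
      (Fin M × Fin (A + B + M * κ) → ZMod p) :=
    LinearMap.pi fun q => lcoeff (ZMod p) q.2 ∘ₗ T q.1
  have hker : LinearMap.ker Λ ≠ ⊥ := by
    apply LinearMap.ker_ne_bot_of_finrank_lt
    have h1 : Module.finrank (ZMod p) (degreeLT (ZMod p) A) = A := by
      rw [(degreeLTEquiv (ZMod p) A).finrank_eq]
      simp
    rw [Module.finrank_pi, Module.finrank_pi_fintype]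
    simp only [h1, sum_const, card_univ, Fintype.card_prod, Fintype.card_fin, smul_eq_mul]
    nlinarith
  obtain ⟨v, hvker, hv0⟩ := Submodule.exists_mem_ne_zero_of_ne_bot hker
  have hTv : ∀ r < M, T r v = 0 := by
    intro r hr
    ext i
    rw [coeff_zero]
    by_cases hi : i < A + B + M * κ
    · exact congrFun (LinearMap.mem_ker.1 hvker) (⟨r, hr⟩, ⟨i, hi⟩)
    · exact coeff_eq_zero_of_natDegree_lt ((hTdeg r hr v).trans_le (not_lt.1 hi))
  set P : ℕ → ℕ → (ZMod p)[X] := fun j b =>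
    if hjb : j < B ∧ b < d then (v (⟨j, hjb.1⟩, ⟨b, hjb.2⟩) : (ZMod p)[X]) else 0 with hPdef
  have hPdeg : ∀ j b, (P j b).natDegree ≤ A := by
    intro j b
    simp only [hPdef]
    split_ifs
    · exact (hvdeg _).le
    · simp
  set Ψ := ∑ j ∈ range B, ∑ b ∈ range d, P j b * (X - C c) ^ (p * j) * f ^ (m * b) with hΨ
  have hΨ0 : Ψ ≠ 0 := by
    refine stepanov_sum_ne_zero hdm hd hf hc hdeg (fun j _ b _ => hPdeg j b) ?_
    obtain ⟨q, hq⟩ := Function.ne_iff.1 hv0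
    refine ⟨q.1, q.1.2, q.2, q.2.2, ?_⟩
    simp only [hPdef]
    rw [dif_pos ⟨q.1.2, q.2.2⟩]
    simpa using hq
  have hiter : ∀ r, (fun Φ : (ZMod p)[X] => g * derivative Φ)^[r] Ψ =
      ∑ j ∈ range B, ∑ b ∈ range d, (L b ^ r) (P j b) * (X - C c) ^ (p * j) * f ^ (m * b) := by
    intro r
    induction r with
    | zero => simp [hΨ]
    | succ r ih =>
      rw [Function.iterate_succ_apply', ih, derivative_sum, mul_sum]
      refine sum_congr rfl fun j _ => ?_
      rw [derivative_sum, mul_sum]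
      refine sum_congr rfl fun b _ => ?_
      rw [pow_succ' (L b), Module.End.mul_apply, hL]
      generalize (L b ^ r) (P j b) = R
      have h1 : derivative ((X - C c) ^ (p * j)) = 0 := by
        rw [derivative_X_sub_C_pow]
        simp
      have h2 : g * derivative (f ^ (m * b)) = C ((m * b : ℕ) : ZMod p) * h * f ^ (m * b) := by
        obtain h0 | h0 := Nat.eq_zero_or_pos (m * b)
        · rw [h0]; simp
        · rw [derivative_pow]
          calc g * (C ((m * b : ℕ) : ZMod p) * f ^ (m * b - 1) * derivative f)
              = C ((m * b : ℕ) : ZMod p) * f ^ (m * b - 1) * (g * derivative f) := by ring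
            _ = C ((m * b : ℕ) : ZMod p) * h * (f ^ (m * b - 1) * f) := by rw [hfgh]; ring
            _ = _ := by rw [← pow_succ, Nat.sub_add_cancel h0]
      rw [derivative_mul, derivative_mul, h1]
      linear_combination R * (X - C c) ^ (p * j) * h2
  have hroot : ∀ x, f.eval x ^ m = ζ → (X - C x) ^ M ∣ Ψ := by
    intro x hx
    refine pow_dvd_of_iterate_derivative_eval_eq_zero (hgf x (hev x hx)) hMp fun r hr => ?_
    have h1 := congrArg (eval x) (hTv r hr)
    rw [hT, eval_zero, Fintype.sum_prod_type] at h1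
    rw [hiter, ← h1, ← Fin.sum_univ_eq_sum_range
      (fun j => ∑ b ∈ range d, (L b ^ r) (P j b) * (X - C c) ^ (p * j) * f ^ (m * b)),
      eval_finsetSum, eval_finsetSum]
    refine sum_congr rfl fun j _ => ?_
    rw [← Fin.sum_univ_eq_sum_range
      (fun b => (L b ^ r) (P j b) * (X - C c) ^ (p * j) * f ^ (m * b)),
      eval_finsetSum, eval_finsetSum]
    refine sum_congr rfl fun b _ => ?_
    have h2 : P j b = v (j, b) := by
      simp only [hPdef]
      rw [dif_pos ⟨j.2, b.2⟩]
    simp only [eval_mul, eval_pow, eval_sub, eval_X, eval_C, h2, pow_mul, ZMod.pow_card, hx]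
    ring
  have hprod : ∏ x ∈ univ.filter (fun x : ZMod p => f.eval x ^ m = ζ), (X - C x) ^ M ∣ Ψ := by
    refine Finset.prod_dvd_of_coprime ?_ fun x hx => hroot x (mem_filter.1 hx).2
    intro x _ y _ hxy
    exact (pairwise_coprime_X_sub_C Function.injective_id hxy).pow
  have hle := natDegree_le_of_dvd hprod hΨ0
  rw [natDegree_prod_of_monic _ _ fun x _ => (monic_X_sub_C x).pow M] at hle
  simp only [natDegree_pow, natDegree_X_sub_C, mul_one, sum_const, smul_eq_mul] at hle
  refine hle.trans ?_
  have hd1 : 1 ≤ d := Nat.one_le_iff_ne_zero.2 hd.ne_zero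
  have hAp : A ≤ p := by nlinarith
  rw [hΨ]
  refine natDegree_sum_le_of_forall_le _ _ fun j hj => natDegree_sum_le_of_forall_le _ _
    fun b hb => ?_
  refine (natDegree_mul_le.trans (Nat.add_le_add_right natDegree_mul_le _)).trans ?_
  rw [natDegree_pow, natDegree_pow, natDegree_X_sub_C, mul_one]
  have h1 : m * b ≤ p := by
    have : m * b ≤ m * d := Nat.mul_le_mul_left _ (mem_range.1 hb).le
    omega
  have h2 := hPdeg j b
  have h3 := mem_range.1 hj
  have h4 : p * j + p ≤ p * B := by nlinarith
  have h5 : m * b * f.natDegree ≤ p * f.natDegree := Nat.mul_le_mul_right _ h1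
  rw [mul_add]
  omega

open Polynomial Finset in
theorem shiftProd_deriv {F : Type*} [Field F] [DecidableEq F] (S : Finset F) (E : F → ℕ) :
    (∏ a ∈ S, (X + C a)) * derivative (∏ a ∈ S, (X + C a) ^ E a) =
      (∑ a ∈ S, C (E a : F) * ∏ b ∈ S.erase a, (X + C b)) * ∏ a ∈ S, (X + C a) ^ E a := by
  rw [derivative_prod_finset, mul_sum, sum_mul]
  refine sum_congr rfl fun a ha => ?_
  have h1 : derivative ((X + C a) ^ E a) * (X + C a) = C (E a : F) * (X + C a) ^ E a := by
    obtain h0 | h0 := Nat.eq_zero_or_pos (E a)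
    · rw [h0]; simp
    · rw [derivative_X_add_C_pow, mul_assoc, ← pow_succ, Nat.sub_add_cancel h0]
  rw [← mul_prod_erase S (fun a => X + C a) ha, ← mul_prod_erase S (fun a => (X + C a) ^ E a) ha]
  linear_combination (∏ b ∈ S.erase a, (X + C b)) * (∏ b ∈ S.erase a, (X + C b) ^ E b) * h1

open Polynomial Finset in
theorem rootMultiplicity_shiftProd {F : Type*} [Field F] [DecidableEq F] (S : Finset F) (E : F → ℕ)
    {a : F} (ha : a ∈ S) : rootMultiplicity (-a) (∏ a ∈ S, (X + C a) ^ E a) = E a := by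
  rw [← count_roots, roots_prod _ _ (prod_ne_zero_iff.2 fun b _ =>
    pow_ne_zero _ (X_add_C_ne_zero b)),
    Multiset.count_bind]
  simp only [roots_pow, roots_X_add_C, Multiset.count_nsmul]
  change ∑ b ∈ S, _ = _
  rw [sum_eq_single_of_mem a ha]
  · simp
  · intro b _ hb
    rw [Multiset.count_singleton, if_neg (fun h => hb (neg_injective h).symm), mul_zero]

open Finset in
theorem MulChar.sum_rootsOfUnity_eq_zero {p : ℕ} [Fact p.Prime] {d m : ℕ} (hdm : m * d = p - 1)
    (hd : 1 < d) {ω : MulChar (ZMod p) ℂ} (hω : orderOf ω = p - 1) :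
    ∑ ζ : ZMod p with ζ ^ d = 1, ω ζ = 0 := by
  have hp : p.Prime := Fact.out
  have hp2 := hp.two_le
  have hm0 : m ≠ 0 := by rintro rfl; omega
  have h1 : ω ^ m ≠ 1 := by
    intro h
    have := Nat.le_of_dvd (Nat.pos_of_ne_zero hm0) (orderOf_dvd_of_pow_eq_one h)
    rw [hω, ← hdm] at this
    have : m * 2 ≤ m * d := Nat.mul_le_mul_left _ hd
    omega
  obtain ⟨γ, hγ⟩ := (MulChar.ne_one_iff).1 h1
  have hγ' : ω ((γ : ZMod p) ^ m) ≠ 1 := by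
    rwa [map_pow, ← MulChar.pow_apply' ω hm0]
  have hη : ((γ : ZMod p) ^ m) ^ d = 1 := by
    rw [← pow_mul, hdm, ZMod.pow_card_sub_one_eq_one γ.ne_zero]
  have h2 : ∑ ζ : ZMod p with ζ ^ d = 1, ω ζ =
      ω ((γ : ZMod p) ^ m) * ∑ ζ : ZMod p with ζ ^ d = 1, ω ζ := by
    rw [mul_sum]
    symm
    refine sum_bij (fun ζ _ => (γ : ZMod p) ^ m * ζ) ?_ ?_ ?_ ?_
    · intro ζ hζ
      rw [mem_filter] at hζ ⊢
      exact ⟨mem_univ _, by rw [mul_pow, hη, hζ.2, one_mul]⟩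
    · intro a _ b _ hab
      exact mul_left_cancel₀ (pow_ne_zero _ γ.ne_zero) hab
    · intro ζ hζ
      refine ⟨((γ : ZMod p) ^ m)⁻¹ * ζ, ?_, ?_⟩
      · rw [mem_filter] at hζ ⊢
        exact ⟨mem_univ _, by rw [mul_pow, inv_pow, hη, hζ.2, inv_one, one_mul]⟩
      · exact mul_inv_cancel_left₀ (pow_ne_zero _ γ.ne_zero) _
    · intro ζ _
      rw [map_mul]
  have h3 : (ω ((γ : ZMod p) ^ m) - 1) * ∑ ζ : ZMod p with ζ ^ d = 1, ω ζ = 0 := by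
    rw [sub_mul, one_mul, ← h2, sub_self]
  exact (mul_eq_zero.1 h3).resolve_left (sub_ne_zero.2 hγ')

open Polynomial Finset in
/-- A power-saving bound for sums of a multiplicative character of squarefree order `d` over a
product of shifts. -/
theorem norm_charSum_le {p : ℕ} [Fact p.Prime] {d m K B : ℕ} (hdm : m * d = p - 1) (hd1 : 1 < d)
    (hd : Squarefree d) {ω : MulChar (ZMod p) ℂ} (hω : orderOf ω = p - 1)
    {S : Finset (ZMod p)} {E : ZMod p → ℕ} (hE0 : ∀ a ∈ S, E a ≠ 0)
    (hE : ∀ l : ℕ, l.Prime → l ∣ d → ∃ a ∈ S, ¬ l ∣ E a)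
    (hS : #S ≤ K) (hdegE : ∑ a ∈ S, E a ≤ K * d) (hB : 0 < B) (hBp : 2 * K * d ^ 3 * B ^ 2 < p) :
    ‖∑ x : ZMod p, ω (∏ a ∈ S, (x + a) ^ E a) ^ m‖ ≤ 5 * K * d * p / B := by
  classical
  have hp : p.Prime := Fact.out
  have hp2 := hp.two_le
  have hm0 : m ≠ 0 := by rintro rfl; omega
  have hSpos : 0 < #S := by
    obtain ⟨a, ha, -⟩ := hE d.minFac (Nat.minFac_prime hd1.ne') (Nat.minFac_dvd d)
    exact card_pos.2 ⟨a, ha⟩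
  obtain ⟨κ, rfl⟩ : ∃ κ, K = κ + 1 := ⟨K - 1, by omega⟩
  set f : (ZMod p)[X] := ∏ a ∈ S, (X + C a) ^ E a with hf
  have hfev : ∀ x, f.eval x = ∏ a ∈ S, (x + a) ^ E a := by
    intro x; simp [hf, eval_prod]
  have hfdeg : f.natDegree = ∑ a ∈ S, E a := by
    rw [hf, natDegree_prod_of_monic _ _ fun a _ => (monic_X_add_C a).pow _]
    simp
  set N : ZMod p → ℕ := fun ζ => #{x : ZMod p | f.eval x ^ m = ζ} with hN
  have hd3 : d ^ 3 * B ^ 2 = d * d * B * (d * B) := by ring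
  have hNle : ∀ ζ ≠ 0, N ζ * (d * B - 1) ≤ p * (B + (κ + 1) * d) := by
    intro ζ hζ
    have hdB : 0 < d * B := by positivity
    have key : d * (d * B * (B + d * B * κ) + (κ + 1) * d) < p := by
      refine lt_of_le_of_lt ?_ hBp
      have h1 : 1 + d * κ ≤ d * (κ + 1) := by linarith [mul_add d κ 1]
      have h2 : d * d ≤ d * d * (d * B ^ 2) := Nat.le_mul_of_pos_right _ (by positivity)
      calc d * (d * B * (B + d * B * κ) + (κ + 1) * d)
          = d * d * B ^ 2 * (1 + d * κ) + (κ + 1) * (d * d) := by ring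
        _ ≤ d * d * B ^ 2 * (d * (κ + 1)) + (κ + 1) * (d * d * (d * B ^ 2)) := by gcongr
        _ = 2 * (κ + 1) * d ^ 3 * B ^ 2 := by ring
    refine (stepanov_card_le (A := d * B * (B + d * B * κ)) (B := B) (κ := κ) hdm hd (f := f)
      (g := ∏ a ∈ S, (X + C a)) (h := ∑ a ∈ S, C (E a : ZMod p) * ∏ b ∈ S.erase a, (X + C b))
      ?_ (shiftProd_deriv S E) ?_ ?_ ?_ ?_ (by positivity) ?_ ?_ hζ).trans ?_
    · intro l hl hld
      obtain ⟨a, ha, hla⟩ := hE l hl hld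
      exact ⟨-a, by rwa [hf, rootMultiplicity_shiftProd S E ha]⟩
    · intro x hx
      rw [hfev, prod_ne_zero_iff] at hx
      rw [eval_prod, prod_ne_zero_iff]
      intro a ha
      have := hx a ha
      rw [Ne, pow_eq_zero_iff (hE0 a ha)] at this
      simpa using this
    · rw [natDegree_prod_of_monic _ _ fun a _ => monic_X_add_C a]
      simpa using hS
    · refine natDegree_sum_le_of_forall_le _ _ fun a ha => ?_
      refine (natDegree_C_mul_le _ _).trans ?_
      rw [natDegree_prod_of_monic _ _ fun a _ => monic_X_add_C a]
      simp only [natDegree_X_add_C, sum_const, smul_eq_mul, mul_one, card_erase_of_mem ha]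
      omega
    · refine lt_of_le_of_lt ?_ key
      rw [hfdeg]
      gcongr
    · have h1 : d * B ≤ d * B * (B + d * B * κ) := Nat.le_mul_of_pos_right _ (by omega)
      have h2 : d * B * (B + d * B * κ) + (κ + 1) * d ≤
          d * (d * B * (B + d * B * κ) + (κ + 1) * d) := Nat.le_mul_of_pos_left _ (by omega)
      omega
    · obtain ⟨M, hM⟩ : ∃ M, d * B = M + 1 := ⟨d * B - 1, by omega⟩
      rw [hM, Nat.add_sub_cancel]
      have h1 : M * (B + M * κ) < (M + 1) * (B + (M + 1) * κ) := by
        have : M * κ ≤ (M + 1) * κ := by gcongr; omega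
        nlinarith
      calc M * ((M + 1) * (B + (M + 1) * κ) + B + M * κ)
          = M * ((M + 1) * (B + (M + 1) * κ)) + M * (B + M * κ) := by ring
        _ < M * ((M + 1) * (B + (M + 1) * κ)) + (M + 1) * (B + (M + 1) * κ) := by gcongr
        _ = (M + 1) * ((M + 1) * (B + (M + 1) * κ)) := by ring
    · rw [hfdeg]
      gcongr
  have hdB : 2 ≤ d * B := by nlinarith
  set Q : ℝ := p * (B + (κ + 1) * d) / (d * B - 1) with hQ
  have hdBR : (2 : ℝ) ≤ d * B := by exact_mod_cast hdB
  have hNQ : ∀ ζ ≠ 0, (N ζ : ℝ) ≤ Q := by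
    intro ζ hζ
    rw [hQ, le_div_iff₀ (by linarith)]
    have h1 := hNle ζ hζ
    have h2 : ((d * B - 1 : ℕ) : ℝ) = d * B - 1 := by
      rw [Nat.cast_sub (by omega)]; push_cast; ring
    rw [← h2]
    exact_mod_cast h1
  set Z : Finset (ZMod p) := {ζ | ζ ^ d = 1} with hZ
  have hZ0 : ∀ ζ ∈ Z, ζ ≠ 0 := by
    rintro ζ hζ rfl
    rw [hZ, mem_filter, zero_pow (by omega)] at hζ
    exact zero_ne_one hζ.2
  have hZcard : #Z ≤ d := by
    have h1 : Z ⊆ (nthRoots d (1 : ZMod p)).toFinset := by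
      intro ζ hζ
      rw [Multiset.mem_toFinset, mem_nthRoots (by omega)]
      exact (mem_filter.1 hζ).2
    exact (card_le_card h1).trans ((Multiset.toFinset_card_le _).trans (card_nthRoots d 1))
  have hmaps : ∀ x ∈ univ.filter (fun x : ZMod p => f.eval x ≠ 0), f.eval x ^ m ∈ Z := by
    intro x hx
    rw [hZ, mem_filter]
    exact ⟨mem_univ _, by rw [← pow_mul, hdm, ZMod.pow_card_sub_one_eq_one (mem_filter.1 hx).2]⟩
  have hfib : ∀ ζ ∈ Z, ((univ.filter fun x : ZMod p => f.eval x ≠ 0).filter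
      fun x => f.eval x ^ m = ζ) = univ.filter fun x : ZMod p => f.eval x ^ m = ζ := by
    intro ζ hζ
    ext x
    simp only [mem_filter, mem_univ, true_and, and_iff_right_iff_imp]
    rintro hx h0
    rw [h0, zero_pow hm0] at hx
    exact hZ0 ζ hζ hx.symm
  have hsum : ∑ x : ZMod p, ω (∏ a ∈ S, (x + a) ^ E a) ^ m = ∑ ζ ∈ Z, (N ζ : ℂ) * ω ζ := by
    have h1 : ∑ x : ZMod p, ω (∏ a ∈ S, (x + a) ^ E a) ^ m =
        ∑ x : ZMod p with f.eval x ≠ 0, ω (f.eval x ^ m) := by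
      rw [sum_filter]
      refine sum_congr rfl fun x _ => ?_
      rw [← hfev]
      split_ifs with h
      · rw [map_pow]
      · rw [not_not.1 h, MulChar.map_zero, zero_pow hm0]
    rw [h1, ← sum_fiberwise_of_maps_to hmaps]
    refine sum_congr rfl fun ζ hζ => ?_
    rw [hfib ζ hζ, sum_congr rfl fun x hx => by rw [(mem_filter.1 hx).2], sum_const, nsmul_eq_mul]
  have htotal : (p : ℝ) - (κ + 1) ≤ ∑ ζ ∈ Z, (N ζ : ℝ) := by
    have h1 : ∑ ζ ∈ Z, N ζ = #(univ.filter fun x : ZMod p => f.eval x ≠ 0) := by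
      rw [card_eq_sum_card_fiberwise hmaps]
      exact sum_congr rfl fun ζ hζ => by rw [hfib ζ hζ]
    have h2 : #(univ.filter fun x : ZMod p => ¬ f.eval x ≠ 0) ≤ #S := by
      refine (card_le_card (t := S.image fun a => -a) ?_).trans card_image_le
      intro x hx
      have h3 := not_not.1 (mem_filter.1 hx).2
      rw [hfev, prod_eq_zero_iff] at h3
      obtain ⟨a, ha, h3⟩ := h3
      exact mem_image.2 ⟨a, ha, (eq_neg_of_add_eq_zero_left (eq_zero_of_pow_eq_zero h3)).symm⟩
    have h3 := card_filter_add_card_filter_not (s := univ) (fun x : ZMod p => f.eval x ≠ 0)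
    rw [card_univ, ZMod.card] at h3
    have h4 : p ≤ ∑ ζ ∈ Z, N ζ + (κ + 1) := by omega
    have h5 : (p : ℝ) ≤ ∑ ζ ∈ Z, (N ζ : ℝ) + (κ + 1) := by exact_mod_cast h4
    linarith
  have hzero : ∑ ζ ∈ Z, (N ζ : ℂ) * ω ζ = - ∑ ζ ∈ Z, ((Q - N ζ : ℝ) : ℂ) * ω ζ := by
    have := MulChar.sum_rootsOfUnity_eq_zero hdm hd1 hω
    simp only [Complex.ofReal_sub, Complex.ofReal_natCast, sub_mul, sum_sub_distrib, ← mul_sum]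
    rw [this, mul_zero, zero_sub, neg_neg]
  have hQ0 : 0 ≤ Q := by
    rw [hQ]
    exact div_nonneg (by positivity) (by linarith)
  rw [hsum, hzero, norm_neg]
  have hbound : ‖∑ ζ ∈ Z, ((Q - N ζ : ℝ) : ℂ) * ω ζ‖ ≤ d * Q - p + (κ + 1) := by
    calc ‖∑ ζ ∈ Z, ((Q - N ζ : ℝ) : ℂ) * ω ζ‖ ≤ ∑ ζ ∈ Z, (Q - N ζ) := by
          refine norm_sum_le_of_le _ fun ζ hζ => ?_
          have h1 : ‖ω ζ‖ = 1 := by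
            refine Complex.norm_eq_one_of_pow_eq_one (n := d) ?_ (by omega)
            rw [← map_pow, (mem_filter.1 hζ).2, map_one]
          rw [norm_mul, h1, mul_one, Complex.norm_real, Real.norm_of_nonneg]
          linarith [hNQ ζ (hZ0 ζ hζ)]
      _ = #Z * Q - ∑ ζ ∈ Z, (N ζ : ℝ) := by
          rw [sum_sub_distrib, sum_const, nsmul_eq_mul]
      _ ≤ d * Q - (p - (κ + 1)) := by
          gcongr
      _ = _ := by ring
  refine hbound.trans ?_
  have hBle : (B : ℝ) ≤ p := by
    have : B ≤ 2 * (κ + 1) * d ^ 3 * B ^ 2 := by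
      calc B ≤ B ^ 2 := by nlinarith
        _ ≤ _ := Nat.le_mul_of_pos_left _ (by positivity)
    exact_mod_cast this.trans hBp.le
  have hdR : (2 : ℝ) ≤ d := by exact_mod_cast hd1
  have hBR : (1 : ℝ) ≤ B := by exact_mod_cast hB
  have h1 : d * Q - p ≤ 4 * (κ + 1) * d * p / B := by
    have : d * Q - p = p * ((κ + 1) * d ^ 2 + 1) / (d * B - 1) := by
      rw [hQ]
      have : (d : ℝ) * B - 1 ≠ 0 := by linarith
      field_simp
      ring
    rw [this, div_le_div_iff₀ (by linarith) (by linarith)]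
    have hκ : (0 : ℝ) ≤ κ := Nat.cast_nonneg _
    have e1 : ((κ : ℝ) + 1) * (d : ℝ) ^ 2 + 1 ≤ 2 * (κ + 1) * (d : ℝ) ^ 2 := by nlinarith
    have e2 : (d * B : ℝ) ≤ 2 * (d * B - 1) := by linarith
    have hp0 : (0 : ℝ) ≤ p := Nat.cast_nonneg _
    have hc : (0 : ℝ) ≤ 2 * (κ + 1) * d * p := by positivity
    refine (mul_le_mul_of_nonneg_right (mul_le_mul_of_nonneg_left e1 hp0)
      (Nat.cast_nonneg B)).trans ?_
    linarith [mul_le_mul_of_nonneg_left e2 hc]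
  have h2 : (κ + 1 : ℝ) ≤ (κ + 1) * d * p / B := by
    rw [le_div_iff₀ (by linarith)]
    have hκ : (0 : ℝ) ≤ κ := Nat.cast_nonneg _
    calc (κ + 1 : ℝ) * B ≤ (κ + 1) * (d * p) := by
          gcongr
          nlinarith
      _ = _ := by ring
  push_cast
  calc d * Q - p + (κ + 1) ≤ 4 * (κ + 1) * d * p / B + (κ + 1) * d * p / B := add_le_add h1 h2
    _ = _ := by ring

open Finset in
/-- A nontrivial sum of characters of prime orders over shifts has power saving. -/
theorem norm_sum_prod_mulChar_le {p : ℕ} [Fact p.Prime] {ω : MulChar (ZMod p) ℂ}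
    (hω : orderOf ω = p - 1) {ι : Type*} [Fintype ι] {s : ι → ZMod p} {l e : ι → ℕ}
    (hinj : ∀ i j, s i = s j → l i = l j → i = j) (hl : ∀ i, (l i).Prime)
    (hlp : ∀ i, l i ∣ p - 1) (hel : ∀ i, e i < l i) (he : ∃ i, e i ≠ 0) {K B D : ℕ}
    (hK : Fintype.card ι ≤ K) (hD : ∏ i, l i ≤ D) (hB : 0 < B)
    (hBp : 2 * K * D ^ 3 * B ^ 2 < p) :
    ‖∑ x : ZMod p, ∏ i, ω (x + s i) ^ ((p - 1) / l i * e i)‖ ≤ 5 * K * D * p / B := by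
  classical
  have hp : p.Prime := Fact.out
  have hp2 := hp.two_le
  set I : Finset ι := {i | e i ≠ 0} with hI
  have hmI : ∀ i, i ∈ I ↔ e i ≠ 0 := by simp [hI]
  set L : Finset ℕ := I.image l with hL
  set d : ℕ := ∏ q ∈ L, q with hd
  have hLp : ∀ q ∈ L, q.Prime := by
    intro q hq
    obtain ⟨i, -, rfl⟩ := mem_image.1 hq
    exact hl i
  have hdp : d ∣ p - 1 := prod_primes_dvd _ (fun q hq => (hLp q hq).prime) fun q hq => by
    obtain ⟨i, -, rfl⟩ := mem_image.1 hq
    exact hlp i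
  have hdD : d ≤ D := by
    refine (Nat.le_of_dvd (prod_pos fun i _ => (hl i).pos) ?_).trans hD
    refine prod_primes_dvd _ (fun q hq => (hLp q hq).prime) fun q hq => ?_
    obtain ⟨i, -, rfl⟩ := mem_image.1 hq
    exact dvd_prod_of_mem l (mem_univ i)
  have hdsq : Squarefree d := by
    refine squarefree_prod_of_pairwise_isCoprime ?_ fun q hq => (hLp q hq).prime.squarefree
    intro a ha b hb hab
    exact Nat.coprime_iff_isRelPrime.1 ((Nat.coprime_primes (hLp a ha) (hLp b hb)).2 hab)
  have hld : ∀ i ∈ I, l i ∣ d := fun i hi => dvd_prod_of_mem id (mem_image_of_mem l hi)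
  have hdpos : 0 < d := prod_pos fun q hq => (hLp q hq).pos
  obtain ⟨i₀, hi₀⟩ := he
  have hd1 : 1 < d := (hl i₀).one_lt.trans_le (Nat.le_of_dvd hdpos (hld i₀ ((hmI _).2 hi₀)))
  obtain ⟨m, hm⟩ := hdp
  have hdm : m * d = p - 1 := by rw [hm, mul_comm]
  set S : Finset (ZMod p) := I.image s with hS
  set E : ZMod p → ℕ := fun a => ∑ i ∈ I with s i = a, d / l i * e i with hE
  have hmaps : ∀ i ∈ I, s i ∈ S := fun i hi => mem_image_of_mem s hi
  have hpos : ∀ i ∈ I, d / l i * e i ≠ 0 := fun i hi => mul_ne_zero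
    (Nat.div_pos (Nat.le_of_dvd hdpos (hld i hi)) (hl i).pos).ne' ((hmI i).1 hi)
  have key := norm_charSum_le (K := K) (B := B) (S := S) (E := E) hdm hd1 hdsq hω ?_ ?_ ?_ ?_ hB ?_
  · have heq : ∀ x : ZMod p, ∏ i, ω (x + s i) ^ ((p - 1) / l i * e i) =
        ω (∏ a ∈ S, (x + a) ^ E a) ^ m := by
      intro x
      rw [map_prod, ← prod_pow, ← prod_subset (subset_univ I),
        ← prod_fiberwise_of_maps_to hmaps]
      · refine prod_congr rfl fun a ha => ?_
        rw [map_pow, ← pow_mul, hE, sum_mul, ← prod_pow_eq_pow_sum]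
        refine prod_congr rfl fun i hi => ?_
        obtain ⟨hiI, rfl⟩ := mem_filter.1 hi
        congr 1
        obtain ⟨c, hc⟩ := hld i hiI
        rw [hm, hc, mul_assoc, Nat.mul_div_cancel_left _ (hl i).pos,
          Nat.mul_div_cancel_left _ (hl i).pos]
        ring
      · intro i _ hi
        rw [hmI, not_not] at hi
        rw [hi, mul_zero, pow_zero]
    rw [sum_congr rfl fun x _ => heq x]
    refine key.trans ?_
    gcongr
  · intro a ha
    obtain ⟨i, hi, rfl⟩ := mem_image.1 ha
    rw [hE, Ne, sum_eq_zero_iff]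
    exact fun h => hpos i hi (h i (mem_filter.2 ⟨hi, rfl⟩))
  · intro q hq hqd
    have hqL : q ∈ L := by
      obtain ⟨r, hr, hqr⟩ := (hq.prime.dvd_finsetProd_iff _).1 hqd
      rwa [(Nat.prime_dvd_prime_iff_eq hq (hLp r hr)).1 hqr]
    obtain ⟨i, hi, rfl⟩ := mem_image.1 hqL
    refine ⟨s i, hmaps i hi, ?_⟩
    have hmem : i ∈ I.filter fun j => s j = s i := mem_filter.2 ⟨hi, rfl⟩
    change ¬ l i ∣ ∑ j ∈ I with s j = s i, d / l j * e j
    rw [← add_sum_erase _ _ hmem]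
    have hrest : l i ∣ ∑ j ∈ (I.filter fun j => s j = s i).erase i, d / l j * e j := by
      refine dvd_sum fun j hj => Dvd.dvd.mul_right ?_ _
      rw [mem_erase, mem_filter] at hj
      have hne : l i ≠ l j := fun h => hj.1 (hinj j i hj.2.2 h.symm)
      refine ((Nat.coprime_primes (hl i) (hl j)).2 hne).dvd_of_dvd_mul_left ?_
      rw [Nat.mul_div_cancel' (hld j hj.2.1)]
      exact hld i hi
    rw [Nat.dvd_add_left hrest, (hl i).dvd_mul, not_or]
    constructor
    · rintro ⟨c, hc⟩
      have : l i * l i ∣ d := ⟨c, by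
        rw [mul_assoc, ← hc, Nat.mul_div_cancel' (hld i hi)]⟩
      exact (hl i).one_lt.ne' (Nat.isUnit_iff.1 (hdsq _ this))
    · exact Nat.not_dvd_of_pos_of_lt (Nat.pos_of_ne_zero ((hmI i).1 hi)) (hel i)
  · exact card_image_le.trans ((card_le_univ I).trans hK)
  · rw [hE, sum_fiberwise_of_maps_to hmaps]
    calc ∑ i ∈ I, d / l i * e i ≤ ∑ i ∈ I, d := by
          refine sum_le_sum fun i hi => ?_
          exact (Nat.mul_le_mul_left _ (hel i).le).trans (Nat.div_mul_le_self _ _)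
      _ = #I * d := by rw [sum_const, smul_eq_mul]
      _ ≤ K * d := Nat.mul_le_mul_right _ ((card_le_univ I).trans hK)
  · refine lt_of_le_of_lt ?_ hBp
    gcongr

open Finset in
theorem exists_mulChar_orderOf_pred (p : ℕ) [Fact p.Prime] :
    ∃ ω : MulChar (ZMod p) ℂ, orderOf ω = p - 1 := by
  have hp : p.Prime := Fact.out
  have hp2 := hp.two_le
  refine MulChar.exists_mulChar_orderOf (ZMod p) (n := p - 1) ?_
    (Complex.isPrimitiveRoot_exp (p - 1) (by omega))
  rw [ZMod.card]

open Finset in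
theorem sum_mulChar_pow_eq_ite {p : ℕ} [Fact p.Prime] {ω : MulChar (ZMod p) ℂ}
    (hω : orderOf ω = p - 1) {l : ℕ} (hl : 0 < l) (hlp : l ∣ p - 1) {y : ZMod p} (hy : y ≠ 0) :
    (l : ℂ)⁻¹ * ∑ e ∈ range l, ω y ^ ((p - 1) / l * e) =
      if y ^ ((p - 1) / l) = 1 then 1 else 0 := by
  have hp : p.Prime := Fact.out
  have hl0 : (l : ℂ) ≠ 0 := by exact_mod_cast hl.ne'
  have hpl : (p - 1) / l * l = p - 1 := Nat.div_mul_cancel hlp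
  simp only [pow_mul]
  split_ifs with h
  · rw [← map_pow, h, map_one]
    simp [hl0]
  · have h1 : ω y ^ ((p - 1) / l) ≠ 1 := by
      intro h1
      obtain ⟨g, hg⟩ := IsCyclic.exists_generator (α := (ZMod p)ˣ)
      set m := (p - 1) / l
      obtain ⟨k, hk'⟩ : ∃ k : ℕ, g ^ k = Units.mk0 y hy := by
        have := (mem_powers_iff_mem_zpowers (x := g) (y := Units.mk0 y hy)).2 (hg _)
        exact Submonoid.mem_powers_iff _ _ |>.1 this
      have hyk : y = (g : ZMod p) ^ k := by
        have := congrArg Units.val hk'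
        simpa using this.symm
      have h2 : ω ^ (k * m) = 1 := by
        by_cases hkm : k * m = 0
        · rw [hkm, pow_zero]
        ext u
        obtain ⟨j, hj⟩ : ∃ j : ℕ, g ^ j = u :=
          Submonoid.mem_powers_iff _ _ |>.1 (mem_powers_iff_mem_zpowers.2 (hg u))
        rw [← hj, MulChar.pow_apply' ω hkm, MulChar.one_apply_coe, Units.val_pow_eq_pow_val,
          map_pow, ← pow_mul, mul_comm j, pow_mul, pow_mul, ← map_pow, ← hyk, h1, one_pow]
      have h3 := orderOf_dvd_of_pow_eq_one h2
      rw [hω] at h3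
      obtain ⟨c, hc⟩ := h3
      apply h
      rw [hyk, ← pow_mul, hc, pow_mul, ZMod.pow_card_sub_one_eq_one g.ne_zero, one_pow]
    rw [geom_sum_eq h1, ← pow_mul, hpl, ← map_pow, ZMod.pow_card_sub_one_eq_one hy, map_one]
    simp

open Finset in
/-- Values at shifts are simultaneously residues of given prime power types with the expected
frequency. -/
theorem abs_card_powerResidue_sub_le {p : ℕ} [Fact p.Prime] {S : Finset (ZMod p)}
    {U : Finset (ZMod p × ℕ)} (hUS : ∀ u ∈ U, u.1 ∈ S) (hU : ∀ u ∈ U, u.2.Prime)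
    (hUp : ∀ u ∈ U, u.2 ∣ p - 1) {K B D : ℕ} (hUK : #U ≤ K) (hSK : #S ≤ K)
    (hD : ∏ u ∈ U, u.2 ≤ D) (hB : 0 < B) (hBp : 2 * K * D ^ 3 * B ^ 2 < p) :
    |(#{x : ZMod p | (∀ a ∈ S, x + a ≠ 0) ∧ ∀ u ∈ U, (x + u.1) ^ ((p - 1) / u.2) = 1} : ℝ) -
      p * ∏ u ∈ U, (u.2 : ℝ)⁻¹| ≤ 5 * K * D * p / B + K := by
  classical
  obtain ⟨ω, hω⟩ := exists_mulChar_orderOf_pred p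
  set Ω : Finset (ZMod p) := {x | ∀ a ∈ S, x + a ≠ 0} with hΩ
  set F : (U → ℕ) → ZMod p → ℂ := fun e x =>
    ∏ u : U, ω (x + u.1.1) ^ ((p - 1) / u.1.2 * e u) with hF
  set P : Finset (U → ℕ) := Fintype.piFinset fun u : U => range u.1.2 with hP
  set c : ℂ := ∏ u : U, (u.1.2 : ℂ)⁻¹ with hc
  have hcP : c * #P = 1 := by
    rw [hP, Fintype.card_piFinset, hc]
    push_cast
    rw [← prod_mul_distrib]
    refine prod_eq_one fun u _ => ?_
    rw [card_range]
    exact inv_mul_cancel₀ (by exact_mod_cast (hU u.1 u.2).pos.ne')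
  have hcnorm : ‖c‖ * #P = 1 := by
    have := congrArg norm hcP
    rwa [norm_mul, Complex.norm_natCast, norm_one] at this
  have hcount : (#{x : ZMod p | (∀ a ∈ S, x + a ≠ 0) ∧
      ∀ u ∈ U, (x + u.1) ^ ((p - 1) / u.2) = 1} : ℂ) = c * ∑ e ∈ P, ∑ x ∈ Ω, F e x := by
    rw [← filter_filter, card_filter]
    push_cast
    rw [sum_comm, mul_sum]
    refine sum_congr rfl fun x hx => ?_
    have hx0 : ∀ a ∈ S, x + a ≠ 0 := (mem_filter.1 hx).2
    rw [hP, hF, ← prod_univ_sum (fun u : U => range u.1.2)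
      (fun u j => ω (x + u.1.1) ^ ((p - 1) / u.1.2 * j)), hc, ← prod_mul_distrib]
    rw [prod_congr rfl fun u _ => sum_mulChar_pow_eq_ite hω (hU u.1 u.2).pos (hUp u.1 u.2)
      (hx0 _ (hUS u.1 u.2))]
    rw [prod_coe_sort U (fun u => if (x + u.1) ^ ((p - 1) / u.2) = 1 then (1 : ℂ) else 0),
      prod_ite_zero]
    simp
  have hΩcard : #(univ.filter fun x : ZMod p => ¬ ∀ a ∈ S, x + a ≠ 0) ≤ K := by
    refine ((card_le_card (t := S.image fun a => -a) ?_).trans card_image_le).trans hSK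
    intro x hx
    have h3 := (mem_filter.1 hx).2
    push Not at h3
    obtain ⟨a, ha, h3⟩ := h3
    exact mem_image.2 ⟨a, ha, (eq_neg_of_add_eq_zero_left h3).symm⟩
  have hF1 : ∀ e x, ‖F e x‖ ≤ 1 := by
    intro e x
    rw [hF, norm_prod]
    refine prod_le_one (fun _ _ => norm_nonneg _) fun u _ => ?_
    rw [norm_pow]
    refine pow_le_one₀ (norm_nonneg _) ?_
    by_cases h : x + u.1.1 = 0
    · rw [h, MulChar.map_zero, norm_zero]
      exact zero_le_one
    · refine (Complex.norm_eq_one_of_pow_eq_one (n := p - 1) ?_ ?_).le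
      · rw [← map_pow, ZMod.pow_card_sub_one_eq_one h, map_one]
      · have := (Fact.out : p.Prime).two_le
        omega
  have hdiff : ∀ e, ‖∑ x ∈ Ω, F e x - ∑ x, F e x‖ ≤ K := by
    intro e
    rw [← sum_filter_add_sum_filter_not univ (fun x : ZMod p => ∀ a ∈ S, x + a ≠ 0) (F e),
      sub_add_cancel_left, norm_neg]
    refine (norm_sum_le_of_le _ fun x _ => hF1 e x).trans ?_
    simpa using hΩcard
  have h0P : (0 : U → ℕ) ∈ P := by
    rw [hP, Fintype.mem_piFinset]
    exact fun u => mem_range.2 (hU u.1 u.2).pos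
  have hterm : ∀ e ∈ P, ‖∑ x ∈ Ω, F e x - if e = 0 then (p : ℂ) else 0‖ ≤
      5 * K * D * p / B + K := by
    intro e he
    have hnn : (0 : ℝ) ≤ 5 * K * D * p / B := by positivity
    split_ifs with h
    · have : ∑ x, F e x = p := by
        simp [hF, h, ZMod.card]
      rw [← this]
      exact (hdiff e).trans (by linarith)
    · rw [sub_zero]
      have h1 : ‖∑ x, F e x‖ ≤ 5 * K * D * p / B := by
        refine norm_sum_prod_mulChar_le hω (ι := U) (s := fun u => u.1.1) (l := fun u => u.1.2)
          (e := e) ?_ (fun u => hU u.1 u.2) (fun u => hUp u.1 u.2) ?_ ?_ ?_ ?_ hB hBp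
        · exact fun i j h1 h2 => Subtype.ext (Prod.ext h1 h2)
        · exact fun u => mem_range.1 ((Fintype.mem_piFinset.1 he) u)
        · by_contra! h'
          exact h (funext h')
        · simpa using hUK
        · rwa [prod_coe_sort U fun u => u.2]
      calc ‖∑ x ∈ Ω, F e x‖ = ‖∑ x, F e x + (∑ x ∈ Ω, F e x - ∑ x, F e x)‖ := by congr 1; ring
        _ ≤ _ := (norm_add_le _ _).trans (add_le_add h1 (hdiff e))
  have hmain : ‖(#{x : ZMod p | (∀ a ∈ S, x + a ≠ 0) ∧
      ∀ u ∈ U, (x + u.1) ^ ((p - 1) / u.2) = 1} : ℂ) - p * c‖ ≤ 5 * K * D * p / B + K := by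
    have : (p : ℂ) * c = c * ∑ e ∈ P, if e = 0 then (p : ℂ) else 0 := by
      rw [sum_ite_eq' P, if_pos h0P, mul_comm]
    rw [hcount, this, ← mul_sub, ← sum_sub_distrib, norm_mul]
    calc ‖c‖ * ‖∑ e ∈ P, (∑ x ∈ Ω, F e x - if e = 0 then (p : ℂ) else 0)‖
        ≤ ‖c‖ * (#P * (5 * K * D * p / B + K)) := by
          refine mul_le_mul_of_nonneg_left ?_ (norm_nonneg _)
          refine (norm_sum_le_of_le _ hterm).trans ?_
          rw [sum_const, nsmul_eq_mul]
      _ = _ := by rw [← mul_assoc, hcnorm, one_mul]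
  have hcR : c = ((∏ u ∈ U, (u.2 : ℝ)⁻¹ : ℝ) : ℂ) := by
    rw [hc, prod_coe_sort U fun u => ((u.2 : ℕ) : ℂ)⁻¹]
    push_cast
    rfl
  rw [hcR] at hmain
  rw [← Real.norm_eq_abs, ← Complex.norm_real]
  push_cast at hmain ⊢
  exact hmain

open Finset in
theorem sum_powersetCard_succ_insert {ι : Type*} [DecidableEq ι] {I : Finset ι} {a : ι}
    (ha : a ∉ I) (q : ι → ℝ) (j : ℕ) :
    ∑ U ∈ (insert a I).powersetCard (j + 1), ∏ i ∈ U, q i =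
      ∑ U ∈ I.powersetCard (j + 1), ∏ i ∈ U, q i + q a * ∑ U ∈ I.powersetCard j, ∏ i ∈ U, q i := by
  have hmem : ∀ U ∈ I.powersetCard j, a ∉ U := fun U hU h => ha ((mem_powersetCard.1 hU).1 h)
  rw [powersetCard_succ_insert ha, sum_union, sum_image, mul_sum]
  · congr 1
    exact sum_congr rfl fun U hU => prod_insert (hmem U hU)
  · intro U hU V hV hUV
    rw [← erase_insert (hmem U hU), ← erase_insert (hmem V hV)]
    exact congrArg (fun W => W.erase a) hUV
  · rw [disjoint_left]
    intro U hU hU'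
    obtain ⟨V, -, rfl⟩ := mem_image.1 hU'
    exact ha ((mem_powersetCard.1 hU).1 (mem_insert_self a V))

open Finset in
/-- Bonferroni inequalities for products `∏ (1 - q i)`. -/
theorem bonferroni_prod {ι : Type*} [DecidableEq ι] (I : Finset ι) {q : ι → ℝ}
    (h0 : ∀ i ∈ I, 0 ≤ q i) (h1 : ∀ i ∈ I, q i ≤ 1) (R : ℕ) :
    0 ≤ (-1) ^ R * (∏ i ∈ I, (1 - q i) -
        ∑ j ∈ range R, (-1) ^ j * ∑ U ∈ I.powersetCard j, ∏ i ∈ U, q i) ∧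
      (-1) ^ R * (∏ i ∈ I, (1 - q i) -
        ∑ j ∈ range R, (-1) ^ j * ∑ U ∈ I.powersetCard j, ∏ i ∈ U, q i) ≤
      ∑ U ∈ I.powersetCard R, ∏ i ∈ U, q i := by
  induction I using Finset.induction_on generalizing R with
  | empty =>
    cases R with
    | zero => simp
    | succ R =>
      have : ∑ j ∈ range (R + 1), (-1 : ℝ) ^ j * ∑ U ∈ (∅ : Finset ι).powersetCard j, ∏ i ∈ U, q i
          = 1 := by
        rw [sum_range_succ', sum_eq_zero]
        · simp
        · intro j _
          rw [powersetCard_eq_empty.2 (by simp), sum_empty, mul_zero]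
      rw [this]
      simp [powersetCard_eq_empty.2 (show #(∅ : Finset ι) < R + 1 by simp)]
  | insert a I ha ih =>
    have ih := ih (fun i hi => h0 i (mem_insert_of_mem hi))
      (fun i hi => h1 i (mem_insert_of_mem hi))
    have ha0 := h0 a (mem_insert_self a I)
    have ha1 := h1 a (mem_insert_self a I)
    rw [prod_insert ha]
    cases R with
    | zero =>
      have := ih 0
      simp only [range_zero, sum_empty, pow_zero, sub_zero, one_mul, powersetCard_zero,
        sum_singleton, prod_empty] at this ⊢
      exact ⟨mul_nonneg (by linarith) this.1, mul_le_one₀ (by linarith) this.1 this.2⟩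
    | succ R =>
      obtain ⟨l1, u1⟩ := ih (R + 1)
      obtain ⟨l2, u2⟩ := ih R
      have key : (-1 : ℝ) ^ (R + 1) * ((1 - q a) * ∏ i ∈ I, (1 - q i) -
          ∑ j ∈ range (R + 1), (-1) ^ j * ∑ U ∈ (insert a I).powersetCard j, ∏ i ∈ U, q i) =
          (-1) ^ (R + 1) * (∏ i ∈ I, (1 - q i) -
            ∑ j ∈ range (R + 1), (-1) ^ j * ∑ U ∈ I.powersetCard j, ∏ i ∈ U, q i) +
          q a * ((-1) ^ R * (∏ i ∈ I, (1 - q i) -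
            ∑ j ∈ range R, (-1) ^ j * ∑ U ∈ I.powersetCard j, ∏ i ∈ U, q i)) := by
        have h2 : ∑ j ∈ range (R + 1), (-1 : ℝ) ^ j *
              ∑ U ∈ (insert a I).powersetCard j, ∏ i ∈ U, q i =
            ∑ j ∈ range (R + 1), (-1) ^ j * ∑ U ∈ I.powersetCard j, ∏ i ∈ U, q i -
            q a * ∑ j ∈ range R, (-1) ^ j * ∑ U ∈ I.powersetCard j, ∏ i ∈ U, q i := by
          rw [sum_range_succ', sum_range_succ', sum_congr rfl fun j _ => by
            rw [sum_powersetCard_succ_insert ha, mul_add], sum_add_distrib]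
          have h3 : ∑ j ∈ range R, (-1 : ℝ) ^ (j + 1) *
                (q a * ∑ U ∈ I.powersetCard j, ∏ i ∈ U, q i) =
              - (q a * ∑ j ∈ range R, (-1) ^ j * ∑ U ∈ I.powersetCard j, ∏ i ∈ U, q i) := by
            rw [mul_sum, ← sum_neg_distrib]
            exact sum_congr rfl fun j _ => by ring
          rw [h3]
          simp only [powersetCard_zero, sum_singleton, prod_empty]
          ring
        rw [h2]
        ring
      rw [key, sum_powersetCard_succ_insert ha]
      exact ⟨add_nonneg l1 (mul_nonneg ha0 l2), add_le_add u1 (mul_le_mul_of_nonneg_left u2 ha0)⟩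

open Finset in
theorem factorial_mul_sum_powersetCard_le {ι : Type*} [DecidableEq ι] (I : Finset ι) {q : ι → ℝ}
    (h0 : ∀ i ∈ I, 0 ≤ q i) (R : ℕ) :
    (R.factorial : ℝ) * ∑ U ∈ I.powersetCard R, ∏ i ∈ U, q i ≤ (∑ i ∈ I, q i) ^ R := by
  induction I using Finset.induction_on generalizing R with
  | empty =>
    cases R with
    | zero => simp
    | succ R => simp [powersetCard_eq_empty.2 (show #(∅ : Finset ι) < R + 1 by simp)]
  | insert a I ha ih =>
    have ih := ih (fun i hi => h0 i (mem_insert_of_mem hi))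
    have ha0 := h0 a (mem_insert_self a I)
    cases R with
    | zero => simp
    | succ R =>
      have hs : 0 ≤ ∑ i ∈ I, q i := sum_nonneg fun i hi => h0 i (mem_insert_of_mem hi)
      rw [sum_powersetCard_succ_insert ha, sum_insert ha]
      have hpow : ∀ n : ℕ, ∀ x y : ℝ, 0 ≤ x → 0 ≤ y →
          x ^ (n + 1) + (n + 1) * y * x ^ n ≤ (y + x) ^ (n + 1) := by
        intro n x y hx hy
        induction n with
        | zero => simp [add_comm]
        | succ n ihn =>
          rw [pow_succ (y + x) (n + 1)]
          refine le_trans ?_ (mul_le_mul_of_nonneg_right ihn (add_nonneg hy hx))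
          have : 0 ≤ (n + 1) * y ^ 2 * x ^ n := by positivity
          push_cast
          linear_combination this
      have h1 := ih (R + 1)
      have h2 := mul_le_mul_of_nonneg_left (ih R) (show 0 ≤ (R + 1) * q a by positivity)
      refine le_trans ?_ (hpow R _ _ hs ha0)
      rw [Nat.factorial_succ] at h1 ⊢
      push_cast at h1 ⊢
      linarith

open Finset in
theorem sum_range_choose_le_pow (n R : ℕ) : ∑ j ∈ range (R + 1), n.choose j ≤ (n + 1) ^ R := by
  rw [add_pow]
  refine sum_le_sum fun j hj => ?_
  rw [one_pow, mul_one]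
  calc n.choose j ≤ n ^ j := Nat.choose_le_pow n j
    _ ≤ n ^ j * R.choose j := Nat.le_mul_of_pos_right _
      (Nat.choose_pos (Nat.lt_succ_iff.1 (mem_range.1 hj)))

open Finset in
/-- Truncated inclusion-exclusion: approximate independence of events up to level `R` controls the
number of points at which none of them happens. -/
theorem abs_card_none_sub_le {α ι : Type*} [DecidableEq ι] (Ω : Finset α) (I : Finset ι)
    (P : ι → α → Prop) [∀ i x, Decidable (P i x)] {q : ι → ℝ} (h0 : ∀ i ∈ I, 0 ≤ q i)
    (h1 : ∀ i ∈ I, q i ≤ 1) {M η : ℝ} (hM : 0 ≤ M) (hη : 0 ≤ η) (R : ℕ)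
    (hU : ∀ U ⊆ I, #U ≤ R → |(#{x ∈ Ω | ∀ i ∈ U, P i x} : ℝ) - M * ∏ i ∈ U, q i| ≤ η) :
    |(#{x ∈ Ω | ∀ i ∈ I, ¬ P i x} : ℝ) - M * ∏ i ∈ I, (1 - q i)| ≤
      (#I + 1) ^ R * η + 2 * M * ((∑ i ∈ I, q i) ^ R / R.factorial) := by
  set e : ℕ → ℝ := fun j => ∑ U ∈ I.powersetCard j, ∏ i ∈ U, q i with he
  set n : ℕ → ℝ := fun j => ∑ U ∈ I.powersetCard j, (#{x ∈ Ω | ∀ i ∈ U, P i x} : ℝ) with hn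
  have hprod : ∀ (U : Finset ι), ∑ x ∈ Ω, ∏ i ∈ U, (if P i x then (1 : ℝ) else 0) =
      #{x ∈ Ω | ∀ i ∈ U, P i x} := by
    intro U
    rw [card_filter]
    push_cast
    refine sum_congr rfl fun x _ => ?_
    rw [prod_ite_zero]
    simp
  have hn' : ∀ j, n j = ∑ x ∈ Ω, ∑ U ∈ I.powersetCard j,
      ∏ i ∈ U, (if P i x then (1 : ℝ) else 0) := by
    intro j
    rw [sum_comm]
    exact sum_congr rfl fun U _ => (hprod U).symm
  have hcount : (#{x ∈ Ω | ∀ i ∈ I, ¬ P i x} : ℝ) =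
      ∑ x ∈ Ω, ∏ i ∈ I, (1 - if P i x then (1 : ℝ) else 0) := by
    rw [card_filter]
    push_cast
    refine sum_congr rfl fun x _ => ?_
    rw [prod_congr rfl fun i _ => show (1 - if P i x then (1 : ℝ) else 0) =
      if ¬ P i x then 1 else 0 by split_ifs <;> simp_all, prod_ite_zero]
    simp
  have hdiff : ∀ j ≤ R, |n j - M * e j| ≤ (#I).choose j * η := by
    intro j hj
    rw [hn, he, mul_sum, ← sum_sub_distrib, ← card_powersetCard, ← nsmul_eq_mul, ← sum_const]
    refine (abs_sum_le_sum_abs _ _).trans (sum_le_sum fun U hUm => ?_)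
    obtain ⟨h2, h3⟩ := mem_powersetCard.1 hUm
    exact hU U h2 (h3.trans_le hj)
  have hx := fun x => bonferroni_prod I (q := fun i => if P i x then (1 : ℝ) else 0)
    (fun i _ => by positivity) (fun i _ => by split_ifs <;> norm_num) R
  have hxl := sum_nonneg fun x (_ : x ∈ Ω) => (hx x).1
  have hxu := sum_le_sum fun x (_ : x ∈ Ω) => (hx x).2
  rw [← mul_sum, sum_sub_distrib, ← hcount, sum_comm] at hxl hxu
  simp only [← mul_sum, ← hn'] at hxl hxu
  obtain ⟨hql, hqu⟩ := bonferroni_prod I h0 h1 R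
  replace hqu := mul_le_mul_of_nonneg_left hqu hM
  replace hql := mul_nonneg hM hql
  have heR : e R ≤ (∑ i ∈ I, q i) ^ R / R.factorial := by
    rw [le_div_iff₀ (by positivity), mul_comm]
    exact factorial_mul_sum_powersetCard_le I h0 R
  have hmid : |∑ j ∈ range R, (-1 : ℝ) ^ j * n j - M * ∑ j ∈ range R, (-1) ^ j * e j| ≤
      ∑ j ∈ range R, (#I).choose j * η := by
    rw [mul_sum, ← sum_sub_distrib]
    refine (abs_sum_le_sum_abs _ _).trans (sum_le_sum fun j hj => ?_)
    rw [show (-1 : ℝ) ^ j * n j - M * ((-1) ^ j * e j) = (-1) ^ j * (n j - M * e j) by ring,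
      abs_mul, abs_pow, abs_neg, abs_one, one_pow, one_mul]
    exact hdiff j (mem_range.1 hj).le
  have hchoose : ∑ j ∈ range R, ((#I).choose j : ℝ) * η + (#I).choose R * η ≤ (#I + 1) ^ R * η := by
    rw [← sum_range_succ (fun j => ((#I).choose j : ℝ) * η), ← sum_mul]
    refine mul_le_mul_of_nonneg_right ?_ hη
    exact_mod_cast sum_range_choose_le_pow #I R
  have hR := hdiff R le_rfl
  have heR' := mul_le_mul_of_nonneg_left heR hM
  have hsign : ∀ X : ℝ, |X| = |(-1) ^ R * X| := by
    intro X
    rw [abs_mul, abs_pow, abs_neg, abs_one, one_pow, one_mul]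
  rw [abs_le] at hmid hR
  have hA : |(#{x ∈ Ω | ∀ i ∈ I, ¬ P i x} : ℝ) - ∑ j ∈ range R, (-1 : ℝ) ^ j * n j -
      M * (∏ i ∈ I, (1 - q i) - ∑ j ∈ range R, (-1) ^ j * e j)| ≤
      (#I).choose R * η + 2 * M * ((∑ i ∈ I, q i) ^ R / R.factorial) := by
    have hCη : 0 ≤ ((#I).choose R : ℝ) * η := by positivity
    have hS : 0 ≤ (∑ i ∈ I, q i) ^ R / R.factorial :=
      div_nonneg (pow_nonneg (sum_nonneg h0) _) (by positivity)
    have hMS := mul_nonneg hM hS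
    rw [hsign, abs_le]
    constructor <;> linarith
  rw [abs_le] at hA ⊢
  constructor <;> linarith

/-- The proportion of generators in a cyclic group of order `p - 1`. -/
noncomputable def primRootDensity (p : ℕ) : ℝ := (p - 1).totient / ((p - 1 : ℕ) : ℝ)

theorem primRootDensity_eq_prod {p : ℕ} (hp : 2 ≤ p) :
    primRootDensity p = ∏ l ∈ (p - 1).primeFactors, (1 - (l : ℝ)⁻¹) := by
  have h := Nat.totient_eq_mul_prod_factors (p - 1)
  have h' : ((p - 1).totient : ℝ) =
      ((p - 1 : ℕ) : ℝ) * ∏ l ∈ (p - 1).primeFactors, (1 - (l : ℝ)⁻¹) := by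
    have := congrArg (Rat.cast : ℚ → ℝ) h
    push_cast at this
    exact this
  have h0 : ((p - 1 : ℕ) : ℝ) ≠ 0 := by
    exact_mod_cast (show p - 1 ≠ 0 by omega)
  rw [primRootDensity, h', mul_div_cancel_left₀ _ h0]

open Finset in
theorem one_sub_sum_le_prod_one_sub {ι : Type*} (I : Finset ι) {q : ι → ℝ}
    (h0 : ∀ i ∈ I, 0 ≤ q i) (h1 : ∀ i ∈ I, q i ≤ 1) :
    1 - ∑ i ∈ I, q i ≤ ∏ i ∈ I, (1 - q i) := by
  classical
  have := (bonferroni_prod I h0 h1 2).1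
  simp only [sum_range_succ, range_zero, sum_empty, powersetCard_zero, sum_singleton,
    prod_empty, powersetCard_one, sum_map] at this
  simp only [pow_zero, one_mul, pow_one, zero_add, Function.Embedding.coeFn_mk,
    prod_singleton, even_two, Even.neg_pow, one_pow] at this
  linarith

theorem orderOf_eq_pred_iff {p : ℕ} [Fact p.Prime] (y : ZMod p) :
    orderOf y = p - 1 ↔
      y ≠ 0 ∧ ∀ l ∈ (p - 1).primeFactors, y ^ ((p - 1) / l) ≠ 1 := by
  have hp2 := (Fact.out : p.Prime).two_le
  constructor
  · intro h
    constructor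
    · rintro rfl
      have h1 := pow_orderOf_eq_one (0 : ZMod p)
      rw [h, zero_pow (by omega)] at h1
      exact zero_ne_one h1
    · intro l hl h1
      have hl' := Nat.prime_of_mem_primeFactors hl
      have h2 := orderOf_dvd_of_pow_eq_one h1
      rw [h] at h2
      have h3 := Nat.le_of_dvd (Nat.div_pos (Nat.le_of_dvd (by omega)
        (Nat.dvd_of_mem_primeFactors hl)) hl'.pos) h2
      exact absurd h3 (not_le.2 (Nat.div_lt_self (by omega) hl'.one_lt))
  · rintro ⟨h0, h⟩
    exact orderOf_eq_of_pow_and_pow_div_prime (by omega) (ZMod.pow_card_sub_one_eq_one h0)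
      fun l hl hd => h l (Nat.mem_primeFactors.2 ⟨hl, hd, by omega⟩)

open Finset in
theorem card_primeFactors_le_log (n : ℕ) : #n.primeFactors ≤ Nat.log 2 n := by
  obtain rfl | hn := Nat.eq_zero_or_pos n
  · simp
  refine Nat.le_log_of_pow_le one_lt_two ?_
  calc 2 ^ #n.primeFactors ≤ ∏ l ∈ n.primeFactors, l :=
        pow_card_le_prod _ _ _ fun l hl => (Nat.prime_of_mem_primeFactors hl).two_le
    _ ≤ n := Nat.le_of_dvd hn (Nat.prod_primeFactors_dvd n)

open Finset in
theorem sum_inv_le_add_div {L : Finset ℕ} (hL : ∀ l ∈ L, 1 ≤ l) {z : ℕ} (hz : 0 < z) :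
    ∑ l ∈ L, (l : ℝ)⁻¹ ≤ z + #L / z := by
  have h1 : ∑ l ∈ L with l ≤ z, (l : ℝ)⁻¹ ≤ z := by
    calc ∑ l ∈ L with l ≤ z, (l : ℝ)⁻¹ ≤ ∑ l ∈ L with l ≤ z, (1 : ℝ) := by
          refine sum_le_sum fun l hl => inv_le_one_of_one_le₀ ?_
          exact_mod_cast hL l (mem_filter.1 hl).1
      _ ≤ z := by
          rw [sum_const, nsmul_eq_mul, mul_one]
          have : L.filter (· ≤ z) ⊆ Icc 1 z := fun l hl =>
            mem_Icc.2 ⟨hL l (mem_filter.1 hl).1, (mem_filter.1 hl).2⟩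
          have := card_le_card this
          rw [Nat.card_Icc, Nat.add_sub_cancel] at this
          exact_mod_cast this
  have h2 : ∑ l ∈ L with ¬ l ≤ z, (l : ℝ)⁻¹ ≤ #L / z := by
    calc ∑ l ∈ L with ¬ l ≤ z, (l : ℝ)⁻¹ ≤ ∑ l ∈ L with ¬ l ≤ z, (z : ℝ)⁻¹ := by
          refine sum_le_sum fun l hl => ?_
          have := (mem_filter.1 hl).2
          gcongr
          omega
      _ ≤ #L * (z : ℝ)⁻¹ := by
          rw [sum_const, nsmul_eq_mul]
          gcongr
          exact filter_subset _ _
      _ = _ := (div_eq_mul_inv _ _).symm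
  rw [← sum_filter_add_sum_filter_not L (· ≤ z)]
  exact add_le_add h1 h2

open Finset in
theorem card_add_pow_eq_one_le {p : ℕ} [Fact p.Prime] (a : ZMod p) {n : ℕ} (hn : 0 < n) :
    #{x : ZMod p | (x + a) ^ n = 1} ≤ n := by
  refine le_trans ?_ ((Multiset.toFinset_card_le _).trans (Polynomial.card_nthRoots n (1 : ZMod p)))
  refine card_le_card_of_injOn (fun x => x + a) ?_ fun x _ y _ h => add_right_cancel h
  intro x hx
  simp only [coe_filter, mem_univ, true_and, Set.mem_ofPred_eq] at hx
  simpa [Polynomial.mem_nthRoots hn] using hx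

open Finset in
theorem abs_card_primRoots_sub_le {p : ℕ} [Fact p.Prime] (S : Finset (ZMod p)) {y R K B D : ℕ}
    (hy : 0 < y) (hRK : R ≤ K) (hSK : #S ≤ K) (hD : y ^ R ≤ D) (hB : 0 < B)
    (hBp : 2 * K * D ^ 3 * B ^ 2 < p) :
    |(#{x : ZMod p | ∀ a ∈ S, orderOf (x + a) = p - 1} : ℝ) - p * primRootDensity p ^ #S| ≤
      2 * #S * Nat.log 2 p * p / y + (#S * Nat.log 2 p + 1) ^ R * (5 * K * D * p / B + K) +
      2 * p * ((#S * ∑ l ∈ (p - 1).primeFactors, (l : ℝ)⁻¹) ^ R / R.factorial) := by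
  classical
  have hp2 := (Fact.out : p.Prime).two_le
  set N := Nat.log 2 p with hN
  set L := (p - 1).primeFactors with hL
  have hLN : #L ≤ N := (card_primeFactors_le_log _).trans (Nat.log_mono_right (Nat.sub_le _ _))
  set L₁ := L.filter (· ≤ y) with hL₁
  set L₂ := L.filter (¬ · ≤ y) with hL₂
  have hLprime : ∀ l ∈ L, l.Prime := fun l hl => Nat.prime_of_mem_primeFactors hl
  have hLdvd : ∀ l ∈ L, l ∣ p - 1 := fun l hl => Nat.dvd_of_mem_primeFactors hl
  have hinv0 : ∀ l : ℕ, 0 ≤ (l : ℝ)⁻¹ := fun l => by positivity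
  have hinv1 : ∀ l ∈ L, (l : ℝ)⁻¹ ≤ 1 := fun l hl =>
    inv_le_one_of_one_le₀ (by exact_mod_cast (hLprime l hl).one_lt.le)
  have hsum₂ : ∑ l ∈ L₂, (l : ℝ)⁻¹ ≤ N / y := by
    calc ∑ l ∈ L₂, (l : ℝ)⁻¹ ≤ ∑ l ∈ L₂, (y : ℝ)⁻¹ := by
          refine sum_le_sum fun l hl => ?_
          have := (mem_filter.1 hl).2
          gcongr
          omega
      _ = #L₂ * (y : ℝ)⁻¹ := by rw [sum_const, nsmul_eq_mul]
      _ ≤ N * (y : ℝ)⁻¹ := by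
          gcongr
          exact (card_le_card (filter_subset _ _)).trans hLN
      _ = _ := (div_eq_mul_inv _ _).symm
  set Ω : Finset (ZMod p) := {x | ∀ a ∈ S, x + a ≠ 0} with hΩ
  set P : ZMod p × ℕ → ZMod p → Prop := fun u x => (x + u.1) ^ ((p - 1) / u.2) = 1 with hP
  set A := #{x : ZMod p | ∀ a ∈ S, orderOf (x + a) = p - 1} with hA
  set A₁ := #{x ∈ Ω | ∀ u ∈ S ×ˢ L₁, ¬ P u x} with hA₁
  set ρ₁ := ∏ l ∈ L₁, (1 - (l : ℝ)⁻¹) with hρ₁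
  have hprod : ∏ u ∈ S ×ˢ L₁, (1 - (u.2 : ℝ)⁻¹) = ρ₁ ^ #S := by
    simp [prod_product, hρ₁]
  have hsum : ∑ u ∈ S ×ˢ L₁, (u.2 : ℝ)⁻¹ = #S * ∑ l ∈ L₁, (l : ℝ)⁻¹ := by
    simp [sum_product]
  have hη : (0 : ℝ) ≤ 5 * K * D * p / B + K := by positivity
  have hsieve := abs_card_none_sub_le Ω (S ×ˢ L₁) P (q := fun u => (u.2 : ℝ)⁻¹)
    (fun u _ => hinv0 _) (fun u hu => hinv1 _ (mem_filter.1 (mem_product.1 hu).2).1)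
    (M := p) (η := 5 * K * D * p / B + K) (Nat.cast_nonneg _) hη R (by
      intro U hU hUR
      have hmem : ∀ u ∈ U, u.1 ∈ S ∧ u.2 ∈ L ∧ u.2 ≤ y := by
        intro u hu
        have := mem_product.1 (hU hu)
        exact ⟨this.1, mem_filter.1 this.2⟩
      rw [hΩ, filter_filter]
      refine abs_card_powerResidue_sub_le (S := S) (fun u hu => (hmem u hu).1)
        (fun u hu => hLprime _ (hmem u hu).2.1) (fun u hu => hLdvd _ (hmem u hu).2.1)
        (hUR.trans hRK) hSK ?_ hB hBp
      calc ∏ u ∈ U, u.2 ≤ y ^ #U := prod_le_pow_card _ _ _ fun u hu => (hmem u hu).2.2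
        _ ≤ y ^ R := Nat.pow_le_pow_right hy hUR
        _ ≤ D := hD)
  rw [hprod, hsum] at hsieve
  have hA₁A : A ≤ A₁ := by
    refine card_le_card fun x hx => ?_
    have hx' := (mem_filter.1 hx).2
    rw [mem_filter, hΩ, mem_filter]
    refine ⟨⟨mem_univ _, fun a ha => ((orderOf_eq_pred_iff _).1 (hx' a ha)).1⟩, fun u hu => ?_⟩
    obtain ⟨h1, h2⟩ := mem_product.1 hu
    exact ((orderOf_eq_pred_iff _).1 (hx' _ h1)).2 _ (mem_filter.1 h2).1
  have hAA₁ : A₁ ≤ A + ∑ u ∈ S ×ˢ L₂, (p - 1) / u.2 := by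
    have hsub : Ω.filter (fun x => ∀ u ∈ S ×ˢ L₁, ¬ P u x) ⊆
        (univ.filter fun x : ZMod p => ∀ a ∈ S, orderOf (x + a) = p - 1) ∪
        (S ×ˢ L₂).biUnion fun u => univ.filter fun x : ZMod p =>
          (x + u.1) ^ ((p - 1) / u.2) = 1 := by
      intro x hx
      rw [mem_filter, hΩ, mem_filter] at hx
      rw [mem_union, mem_biUnion, or_iff_not_imp_right]
      intro hn
      refine mem_filter.2 ⟨mem_univ _, fun a ha => (orderOf_eq_pred_iff _).2
        ⟨hx.1.2 a ha, fun l hl h1 => ?_⟩⟩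
      by_cases hly : l ≤ y
      · exact hx.2 (a, l) (mem_product.2 ⟨ha, mem_filter.2 ⟨hl, hly⟩⟩) h1
      · exact hn ⟨(a, l), mem_product.2 ⟨ha, mem_filter.2 ⟨hl, hly⟩⟩,
          mem_filter.2 ⟨mem_univ _, h1⟩⟩
    refine (card_le_card hsub).trans ((card_union_le _ _).trans ?_)
    gcongr
    refine card_biUnion_le.trans (sum_le_sum fun u hu => card_add_pow_eq_one_le _ ?_)
    have hl := (mem_filter.1 (mem_product.1 hu).2).1
    exact Nat.div_pos (Nat.le_of_dvd (by omega) (hLdvd _ hl)) (hLprime _ hl).pos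
  have hlarge : ((∑ u ∈ S ×ˢ L₂, (p - 1) / u.2 : ℕ) : ℝ) ≤ #S * N * p / y := by
    calc ((∑ u ∈ S ×ˢ L₂, (p - 1) / u.2 : ℕ) : ℝ) ≤ ∑ u ∈ S ×ˢ L₂, p * (u.2 : ℝ)⁻¹ := by
          push_cast
          refine sum_le_sum fun u _ => Nat.cast_div_le.trans ?_
          rw [div_eq_mul_inv]
          gcongr
          exact Nat.sub_le _ _
      _ = p * (#S * ∑ l ∈ L₂, (l : ℝ)⁻¹) := by
          simp [← mul_sum, sum_product]
      _ ≤ p * (#S * (N / y)) := by gcongr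
      _ = _ := by ring
  have hρ : primRootDensity p = ρ₁ * ∏ l ∈ L₂, (1 - (l : ℝ)⁻¹) := by
    rw [primRootDensity_eq_prod hp2, hρ₁, prod_filter_mul_prod_filter_not]
  have h01 : ∀ l ∈ L, 0 ≤ 1 - (l : ℝ)⁻¹ ∧ 1 - (l : ℝ)⁻¹ ≤ 1 := fun l hl =>
    ⟨by linarith [hinv1 l hl], by linarith [hinv0 l]⟩
  have hρ₁0 : 0 ≤ ρ₁ := prod_nonneg fun l hl => (h01 l (mem_filter.1 hl).1).1
  have hρ₁1 : ρ₁ ≤ 1 := prod_le_one (fun l hl => (h01 l (mem_filter.1 hl).1).1)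
    fun l hl => (h01 l (mem_filter.1 hl).1).2
  have hρ₂1 : ∏ l ∈ L₂, (1 - (l : ℝ)⁻¹) ≤ 1 := prod_le_one
    (fun l hl => (h01 l (mem_filter.1 hl).1).1) fun l hl => (h01 l (mem_filter.1 hl).1).2
  have hρ₂0 : 0 ≤ ∏ l ∈ L₂, (1 - (l : ℝ)⁻¹) := prod_nonneg fun l hl => (h01 l (mem_filter.1 hl).1).1
  have hρ₂ : 1 - N / y ≤ ∏ l ∈ L₂, (1 - (l : ℝ)⁻¹) := by
    have := one_sub_sum_le_prod_one_sub L₂ (q := fun l => (l : ℝ)⁻¹) (fun l _ => hinv0 l)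
      fun l hl => hinv1 l (mem_filter.1 hl).1
    linarith
  have hpowle : primRootDensity p ^ #S ≤ ρ₁ ^ #S := by
    rw [hρ]
    exact pow_le_pow_left₀ (mul_nonneg hρ₁0 hρ₂0) (mul_le_of_le_one_right hρ₁0 hρ₂1) _
  have hpowge : ρ₁ ^ #S - #S * (N / y) ≤ primRootDensity p ^ #S := by
    rw [hρ, mul_pow]
    have hb := one_add_mul_sub_le_pow (n := #S) (a := ∏ l ∈ L₂, (1 - (l : ℝ)⁻¹)) (by linarith)
    have hpw0 : 0 ≤ ρ₁ ^ #S := pow_nonneg hρ₁0 _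
    have hpw1 : ρ₁ ^ #S ≤ 1 := pow_le_one₀ hρ₁0 hρ₁1
    have hs : 0 ≤ (#S : ℝ) := Nat.cast_nonneg _
    have hsn : 0 ≤ (#S : ℝ) * (N / y) := by positivity
    have h3 : 1 - #S * ((N : ℝ) / y) ≤ (∏ l ∈ L₂, (1 - (l : ℝ)⁻¹)) ^ #S := by
      refine le_trans ?_ hb
      nlinarith
    nlinarith
  have hp0 : (0 : ℝ) ≤ p := Nat.cast_nonneg _
  have hcard : ((#(S ×ˢ L₁) : ℝ) + 1) ^ R * (5 * K * D * p / B + K) ≤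
      (#S * N + 1) ^ R * (5 * K * D * p / B + K) := by
    gcongr
    rw [card_product]
    push_cast
    gcongr
    exact (card_le_card (filter_subset _ _)).trans hLN
  have hsumle : 2 * (p : ℝ) * ((#S * ∑ l ∈ L₁, (l : ℝ)⁻¹) ^ R / R.factorial) ≤
      2 * p * ((#S * ∑ l ∈ L, (l : ℝ)⁻¹) ^ R / R.factorial) := by
    gcongr
    exact filter_subset _ _
  have e1 : (A : ℝ) ≤ A₁ := by exact_mod_cast hA₁A
  have e2 : (A₁ : ℝ) ≤ A + #S * N * p / y := by
    have : (A₁ : ℝ) ≤ A + ((∑ u ∈ S ×ˢ L₂, (p - 1) / u.2 : ℕ) : ℝ) := by exact_mod_cast hAA₁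
    linarith
  have e3 := mul_le_mul_of_nonneg_left hpowle hp0
  have e4 := mul_le_mul_of_nonneg_left hpowge hp0
  have e5 : (p : ℝ) * (ρ₁ ^ #S - #S * (N / y)) = p * ρ₁ ^ #S - #S * N * p / y := by ring
  have e6 : (2 : ℝ) * #S * N * p / y = #S * N * p / y + #S * N * p / y := by ring
  rw [e5] at e4
  rw [e6]
  have e7 : (0 : ℝ) ≤ #S * N * p / y := by positivity
  rw [abs_le] at hsieve ⊢
  constructor <;> linarith

theorem exists_forall_poly_mul_pow_le_two_pow (k m : ℕ) :
    ∃ t₀ : ℕ, ∀ t ≥ t₀, (2 * k * (t + 1) ^ 8 + 4) * (t + 1) ^ m ≤ 2 ^ t := by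
  have h := (tendsto_pow_const_div_const_pow_of_one_lt (8 + m) (one_lt_two (α := ℝ))).eventually
    (ge_mem_nhds (show (0 : ℝ) < 1 / (2 * (2 * k + 4)) by positivity))
  obtain ⟨t₀, ht₀⟩ := Filter.eventually_atTop.1 h
  refine ⟨t₀, fun t ht => ?_⟩
  have h1 := ht₀ (t + 1) (by omega)
  rw [div_le_div_iff₀ (by positivity) (by positivity), one_mul, pow_succ 2 t] at h1
  have h2 : (t + 1) ^ (8 + m) * (2 * k + 4) ≤ 2 ^ t := by
    have : (((t + 1) ^ (8 + m) * (2 * k + 4) : ℕ) : ℝ) ≤ 2 ^ t := by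
      push_cast at h1 ⊢
      linarith
    exact_mod_cast this
  refine le_trans ?_ h2
  have h3 : 1 ≤ (t + 1) ^ 8 := Nat.one_le_pow _ _ (by omega)
  calc (2 * k * (t + 1) ^ 8 + 4) * (t + 1) ^ m
      ≤ (2 * k * (t + 1) ^ 8 + 4 * (t + 1) ^ 8) * (t + 1) ^ m := by gcongr; omega
    _ = _ := by ring

open Finset in
/-- Correlations of primitive roots modulo `p` along shifts agree with the independence heuristic up
to an arbitrary power of `log p`. -/
theorem exists_forall_abs_card_primRoots_sub_le (k C : ℕ) :
    ∃ P₀ : ℕ, ∀ (p : ℕ) [Fact p.Prime], P₀ ≤ p → ∀ S : Finset (ZMod p), #S ≤ k →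
      |(#{x : ZMod p | ∀ a ∈ S, orderOf (x + a) = p - 1} : ℝ) - p * primRootDensity p ^ #S| ≤
        p / (Nat.log 2 p : ℝ) ^ C := by
  obtain ⟨t₁, ht₁⟩ := exists_forall_poly_mul_pow_le_two_pow k (8 * C)
  set t₀ := max t₁ (1542 * k + 6) with ht₀
  refine ⟨2 ^ t₀ ^ 8, fun p _ hpP S hS => ?_⟩
  have hp2 := (Fact.out : p.Prime).two_le
  set N := Nat.log 2 p with hN
  obtain ⟨t, htN, hNt⟩ : ∃ t, t ^ 8 ≤ N ∧ N < (t + 1) ^ 8 := by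
    have hex : ∃ m, N < m ^ 8 := ⟨N + 1, (Nat.lt_succ_self N).trans_le
      (Nat.le_self_pow (by norm_num) _)⟩
    have hm := Nat.find_spec hex
    have hm0 : Nat.find hex ≠ 0 := by
      intro h
      rw [h] at hm
      simp at hm
    refine ⟨Nat.find hex - 1, not_lt.1 (Nat.find_min hex (by omega)), ?_⟩
    rwa [Nat.sub_add_cancel (by omega)]
  have htt : t₀ ≤ t := by
    have h1 : t₀ ^ 8 ≤ N := Nat.le_log_of_pow_le one_lt_two hpP
    exact Nat.lt_succ_iff.1 (lt_of_pow_lt_pow_left₀ 8 (Nat.zero_le _) (h1.trans_lt hNt))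
  have ht_e := ht₁ t ((le_max_left _ _).trans htt)
  have ht_d : 1542 * k + 6 ≤ t := (le_max_right _ _).trans htt
  have hp8 : 2 ^ t ^ 8 ≤ p := (Nat.pow_le_pow_right two_pos htN).trans
    (Nat.pow_log_le_self 2 (by omega))
  have ht5 : t ≤ t ^ 5 := Nat.le_self_pow (by norm_num) t
  have hlin : (2 * k * (t + 1) ^ 8 + 4) ≤ 2 ^ t :=
    (Nat.le_mul_of_pos_right _ (by positivity)).trans ht_e
  have hexp : 5 * t + 3 ≤ t ^ 6 := by
    have : t * 6 ^ 5 ≤ t * t ^ 5 := by gcongr; omega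
    calc 5 * t + 3 ≤ t * 6 ^ 5 := by omega
      _ ≤ t * t ^ 5 := this
      _ = t ^ 6 := by ring
  have hK : 5 * t ^ 5 ≤ 2 ^ t ^ 6 := by
    calc 5 * t ^ 5 ≤ 2 ^ 3 * (2 ^ t) ^ 5 := by
          gcongr
          · norm_num
          · exact Nat.lt_two_pow_self.le
      _ = 2 ^ (5 * t + 3) := by ring
      _ ≤ _ := Nat.pow_le_pow_right two_pos hexp
  have h68 : 13 * t ^ 6 ≤ t ^ 8 := by
    calc 13 * t ^ 6 ≤ t ^ 2 * t ^ 6 := by gcongr; nlinarith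
      _ = t ^ 8 := by ring
  have ht6pos : 0 < t ^ 6 := by
    have : 0 < t := by omega
    positivity
  have hmain := abs_card_primRoots_sub_le S (y := 2 ^ t) (R := t ^ 5) (K := t ^ 5)
    (B := 2 ^ (4 * t ^ 6)) (D := 2 ^ t ^ 6) (by positivity) le_rfl (by omega)
    (by rw [← pow_mul]; exact (congrArg _ (by ring)).le) (by positivity) (by
      calc 2 * t ^ 5 * (2 ^ t ^ 6) ^ 3 * (2 ^ (4 * t ^ 6)) ^ 2
          ≤ 2 ^ t ^ 6 * (2 ^ t ^ 6) ^ 3 * (2 ^ (4 * t ^ 6)) ^ 2 := by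
            gcongr
            exact (Nat.mul_le_mul_right _ (by norm_num)).trans hK
        _ = 2 ^ (12 * t ^ 6) := by ring
        _ < 2 ^ t ^ 8 := Nat.pow_lt_pow_right one_lt_two (by omega)
        _ ≤ p := hp8)
  refine hmain.trans ?_
  have hpR : (0 : ℝ) < p := by positivity
  have htR : (0 : ℝ) < t := by exact_mod_cast (show 0 < t by omega)
  have hSR : (#S : ℝ) ≤ k := by exact_mod_cast hS
  have hNR : (N : ℝ) ≤ (t + 1) ^ 8 := by exact_mod_cast hNt.le
  have T1 : 2 * #S * (N : ℝ) * p / ((2 ^ t : ℕ) : ℝ) ≤ 2 * k * (t + 1) ^ 8 * (p / 2 ^ t) := by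
    push_cast
    rw [mul_div_assoc]
    gcongr
  have hsub : ((#S : ℝ) * N + 1) ^ t ^ 5 ≤ 2 ^ t ^ 6 := by
    have h1 : (#S : ℝ) * N + 1 ≤ 2 ^ t := by
      have h2 : (2 * k * (t + 1) ^ 8 + 4 : ℝ) ≤ 2 ^ t := by exact_mod_cast hlin
      have h3 : (#S : ℝ) * N ≤ k * (t + 1) ^ 8 := by gcongr
      have h4 : (0 : ℝ) ≤ k * (t + 1) ^ 8 := by positivity
      linarith
    calc ((#S : ℝ) * N + 1) ^ t ^ 5 ≤ (2 ^ t) ^ t ^ 5 := by gcongr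
      _ = 2 ^ t ^ 6 := by rw [← pow_mul]; congr 1; ring
  have hKR : 5 * (t : ℝ) ^ 5 ≤ 2 ^ t ^ 6 := by exact_mod_cast hK
  have hinv : (1 : ℝ) / 2 ^ t ^ 6 ≤ 1 / 2 ^ t := by
    gcongr
    · norm_num
    · omega
  have T2 : ((#S : ℝ) * N + 1) ^ t ^ 5 * (5 * ((t ^ 5 : ℕ) : ℝ) * ((2 ^ t ^ 6 : ℕ) : ℝ) * p /
      ((2 ^ (4 * t ^ 6) : ℕ) : ℝ) + ((t ^ 5 : ℕ) : ℝ)) ≤ 2 * (p / 2 ^ t) := by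
    push_cast
    set w : ℝ := 2 ^ t ^ 6 with hw
    have hw0 : 0 < w := by positivity
    have hw4 : (2 : ℝ) ^ (4 * t ^ 6) = w ^ 4 := by rw [hw, ← pow_mul, mul_comm]
    have hp3 : w ^ 3 ≤ p := by
      rw [hw, ← pow_mul]
      have : 2 ^ (t ^ 6 * 3) ≤ p := (Nat.pow_le_pow_right two_pos (by omega)).trans hp8
      exact_mod_cast this
    have ht5w : (t : ℝ) ^ 5 ≤ w := by
      have : (0 : ℝ) ≤ (t : ℝ) ^ 5 := by positivity
      linarith
    rw [hw4]
    calc ((#S : ℝ) * N + 1) ^ t ^ 5 * (5 * (t : ℝ) ^ 5 * w * p / w ^ 4 + (t : ℝ) ^ 5)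
        ≤ w * (w * w * p / w ^ 4 + w) := by gcongr
      _ = p * (1 / w) + w ^ 3 * (1 / w) := by field_simp
      _ ≤ p * (1 / w) + p * (1 / w) := by gcongr
      _ ≤ p * (1 / 2 ^ t) + p * (1 / 2 ^ t) := by gcongr
      _ = _ := by ring
  have hσ : (#S : ℝ) * ∑ l ∈ (p - 1).primeFactors, (l : ℝ)⁻¹ ≤ (t : ℝ) ^ 5 / 6 := by
    have h1 := sum_inv_le_add_div (L := (p - 1).primeFactors) (z := t ^ 4)
      (fun l hl => (Nat.prime_of_mem_primeFactors hl).one_lt.le) (by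
        have : 0 < t := by omega
        positivity)
    have h2 : (#(p - 1).primeFactors : ℝ) ≤ 256 * (t : ℝ) ^ 8 := by
      have h3 : #(p - 1).primeFactors ≤ N :=
        (card_primeFactors_le_log _).trans (Nat.log_mono_right (Nat.sub_le _ _))
      have h4 : (t + 1) ^ 8 ≤ (2 * t) ^ 8 := by gcongr; omega
      have : #(p - 1).primeFactors ≤ 256 * t ^ 8 := by
        calc _ ≤ N := h3
          _ ≤ (2 * t) ^ 8 := hNt.le.trans h4
          _ = _ := by ring
      exact_mod_cast this
    have h5 : (#(p - 1).primeFactors : ℝ) / ((t ^ 4 : ℕ) : ℝ) ≤ 256 * (t : ℝ) ^ 4 := by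
      push_cast
      rw [div_le_iff₀ (by positivity)]
      refine h2.trans (le_of_eq ?_)
      ring
    push_cast at h1 h5
    have h6 : (1542 : ℝ) * k ≤ t := by exact_mod_cast (show 1542 * k ≤ t by omega)
    calc (#S : ℝ) * ∑ l ∈ (p - 1).primeFactors, (l : ℝ)⁻¹ ≤ k * (257 * (t : ℝ) ^ 4) := by
          gcongr
          linarith
      _ = (1542 * k) * (t : ℝ) ^ 4 / 6 := by ring
      _ ≤ t * (t : ℝ) ^ 4 / 6 := by gcongr
      _ = _ := by ring
  have T3 : 2 * (p : ℝ) * ((#S * ∑ l ∈ (p - 1).primeFactors, (l : ℝ)⁻¹) ^ t ^ 5 /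
      (t ^ 5).factorial) ≤ 2 * (p / 2 ^ t) := by
    have h1 : (#S * ∑ l ∈ (p - 1).primeFactors, (l : ℝ)⁻¹) ^ t ^ 5 / (t ^ 5).factorial ≤
        1 / 2 ^ t := by
      calc (#S * ∑ l ∈ (p - 1).primeFactors, (l : ℝ)⁻¹) ^ t ^ 5 / (t ^ 5).factorial
          ≤ ((t : ℝ) ^ 5 / 6) ^ t ^ 5 / (t ^ 5).factorial := by gcongr
        _ = ((t ^ 5 : ℕ) : ℝ) ^ t ^ 5 / (t ^ 5).factorial / 6 ^ t ^ 5 := by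
            rw [div_pow]
            push_cast
            ring
        _ ≤ Real.exp ((t ^ 5 : ℕ) : ℝ) / 6 ^ t ^ 5 := by
            gcongr
            exact Real.pow_div_factorial_le_exp _ (Nat.cast_nonneg _) _
        _ = (Real.exp 1) ^ t ^ 5 / 6 ^ t ^ 5 := by rw [← Real.exp_nat_mul, mul_one]
        _ ≤ 3 ^ t ^ 5 / 6 ^ t ^ 5 := by
            gcongr
            linarith [Real.exp_one_lt_d9]
        _ = 1 / 2 ^ t ^ 5 := by
            rw [← div_pow, ← one_div_pow]
            norm_num
        _ ≤ 1 / 2 ^ t := by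
            gcongr
            norm_num
    calc _ ≤ 2 * (p : ℝ) * (1 / 2 ^ t) := by gcongr
      _ = _ := by ring
  calc _ ≤ 2 * (k : ℝ) * ((t : ℝ) + 1) ^ 8 * (p / 2 ^ t) + 2 * (p / 2 ^ t) + 2 * (p / 2 ^ t) :=
        add_le_add (add_le_add T1 T2) T3
    _ = (2 * k * (t + 1) ^ 8 + 4) * (p / 2 ^ t : ℝ) := by ring
    _ ≤ p / ((t : ℝ) + 1) ^ (8 * C) := by
        have h : ((2 * k * (t + 1) ^ 8 + 4) * (t + 1) ^ (8 * C) : ℝ) ≤ 2 ^ t := by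
          exact_mod_cast ht_e
        rw [← mul_div_assoc, div_le_div_iff₀ (by positivity) (by positivity)]
        calc _ = (p : ℝ) * ((2 * k * (t + 1) ^ 8 + 4) * (t + 1) ^ (8 * C)) := by ring
          _ ≤ _ := by gcongr
    _ ≤ p / (N : ℝ) ^ C := by
        rw [pow_mul]
        have : (0 : ℝ) < N := by
          exact_mod_cast Nat.log_pos one_lt_two hp2
        gcongr

open Finset in
theorem inv_card_add_one_le_prod_one_sub_inv (L : Finset ℕ) (hL : ∀ l ∈ L, 2 ≤ l) :
    1 / (#L + 1 : ℝ) ≤ ∏ l ∈ L, (1 - (l : ℝ)⁻¹) := by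
  induction L using Finset.induction_on_max with
  | empty => simp
  | insert a L hmax ih =>
    have ha : a ∉ L := fun h => (hmax a h).false
    have hsub : L ⊆ Ico 2 a := fun l hl =>
      mem_Ico.2 ⟨hL l (mem_insert_of_mem hl), hmax l hl⟩
    have hcard := card_le_card hsub
    have ha2 := hL a (mem_insert_self a L)
    rw [Nat.card_Ico] at hcard
    rw [prod_insert ha, card_insert_of_notMem ha]
    have ha' : (#L : ℝ) + 2 ≤ a := by exact_mod_cast (show #L + 2 ≤ a by omega)
    have h1 : ((#L : ℝ) + 1) / (#L + 2) ≤ 1 - (a : ℝ)⁻¹ := by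
      have : (a : ℝ)⁻¹ ≤ (#L + 2 : ℝ)⁻¹ := by gcongr
      have h3 : ((#L : ℝ) + 1) / (#L + 2) = 1 - (#L + 2 : ℝ)⁻¹ := by field_simp; ring
      linarith
    calc 1 / (((#L + 1 : ℕ) : ℝ) + 1) = (#L + 1) / (#L + 2) * (1 / (#L + 1)) := by
          push_cast
          field_simp
          ring
      _ ≤ _ := by
          gcongr
          · exact le_trans (by positivity) h1
          · exact ih fun l hl => hL l (mem_insert_of_mem hl)

theorem inv_log_add_one_le_primRootDensity {p : ℕ} (hp : 2 ≤ p) :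
    1 / (Nat.log 2 p + 1 : ℝ) ≤ primRootDensity p := by
  rw [primRootDensity_eq_prod hp]
  refine le_trans ?_ (inv_card_add_one_le_prod_one_sub_inv _ fun l hl =>
    (Nat.prime_of_mem_primeFactors hl).two_le)
  have := (card_primeFactors_le_log (p - 1)).trans (Nat.log_mono_right (b := 2) (Nat.sub_le p 1))
  gcongr

theorem primRootDensity_le_one (p : ℕ) : primRootDensity p ≤ 1 :=
  div_le_one_of_le₀ (by exact_mod_cast Nat.totient_le _) (Nat.cast_nonneg _)

open Finset Classical in
/-- The number of residues `x` modulo `p` such that `x` and `x + h` are primitive roots and no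
residue strictly between them is. -/
noncomputable def primRootGapCount (p h : ℕ) [Fact p.Prime] : ℕ :=
  #{x : ZMod p | (orderOf x = p - 1 ∧ orderOf (x + h) = p - 1) ∧
    ∀ i ∈ Ioo 0 h, orderOf (x + (i : ℕ)) ≠ p - 1}

open Finset in
/-- Counting shifts at which two consecutive primitive roots differ by exactly `h`, from the
correlations of primitive roots. -/
theorem abs_card_primRoot_gap_sub_le {p : ℕ} [Fact p.Prime] {h J : ℕ} (h0 : 0 < h) (hhp : h < p)
    {η : ℝ} (hη0 : 0 ≤ η) (hη : ∀ S : Finset (ZMod p), #S ≤ J + 2 →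
      |(#{x : ZMod p | ∀ a ∈ S, orderOf (x + a) = p - 1} : ℝ) - p * primRootDensity p ^ #S| ≤ η) :
    |(primRootGapCount p h : ℝ) -
      p * primRootDensity p ^ 2 * (1 - primRootDensity p) ^ (h - 1)| ≤
      h ^ J * η +
        2 * (p * primRootDensity p ^ 2) * ((h * primRootDensity p) ^ J / J.factorial) := by
  classical
  have hp2 := (Fact.out : p.Prime).two_le
  have hρ0 : 0 ≤ primRootDensity p := by unfold primRootDensity; positivity
  have key := abs_card_none_sub_le
    ({x : ZMod p | orderOf x = p - 1 ∧ orderOf (x + h) = p - 1} : Finset (ZMod p)) (Ioo 0 h)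
    (fun (i : ℕ) x => orderOf (x + (i : ZMod p)) = p - 1) (q := fun _ => primRootDensity p)
    (fun _ _ => hρ0) (fun _ _ => primRootDensity_le_one p)
    (M := p * primRootDensity p ^ 2) (by positivity) hη0 J (by
      intro U hU hUJ
      have hinj : Set.InjOn (fun i : ℕ => (i : ZMod p)) (insert 0 (insert h U) : Finset ℕ) := by
        intro i hi j hj hij
        have hlt : ∀ i ∈ (insert 0 (insert h U) : Finset ℕ), i < p := by
          intro i hi
          rw [mem_insert, mem_insert] at hi
          rcases hi with rfl | rfl | hi
          · omega
          · exact hhp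
          · have := mem_Ioo.1 (hU hi)
            omega
        exact Nat.ModEq.eq_of_lt_of_lt ((ZMod.natCast_eq_natCast_iff _ _ _).1 hij)
          (hlt i hi) (hlt j hj)
      have hcard : #((insert 0 (insert h U)).image fun i : ℕ => (i : ZMod p)) = #U + 2 := by
        have hhU : h ∉ U := fun hh => (mem_Ioo.1 (hU hh)).2.false
        have h0U : 0 ∉ insert h U := by
          rw [mem_insert, not_or]
          exact ⟨h0.ne, fun hh => (mem_Ioo.1 (hU hh)).1.false⟩
        rw [card_image_of_injOn hinj, card_insert_of_notMem h0U, card_insert_of_notMem hhU]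
      have := hη ((insert 0 (insert h U)).image fun i : ℕ => (i : ZMod p)) (by omega)
      rw [hcard] at this
      rw [prod_const, filter_filter, mul_assoc, ← pow_add, add_comm 2]
      convert this using 5
      ext x
      simp [and_assoc])
  rw [filter_filter, prod_const, sum_const, Nat.card_Ioo, nsmul_eq_mul] at key
  rw [primRootGapCount]
  have hc : ((h - 1 : ℕ) : ℝ) + 1 = h := by
    exact_mod_cast (show h - 1 + 1 = h by omega)
  rw [Nat.sub_zero, hc] at key
  have key' : _ ≤ (h : ℝ) ^ J * η +
      2 * (p * primRootDensity p ^ 2) * ((h * primRootDensity p) ^ J / J.factorial) :=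
    key.trans (by gcongr; exact Nat.sub_le h 1)
  convert key' using 5
  ext x
  simp

open Finset in
theorem card_consecutive_le_card_sort_gap (s : Finset ℕ) {h : ℕ} (h0 : 0 < h) :
    #{x ∈ s | x + h ∈ s ∧ ∀ i ∈ Ioo 0 h, x + i ∉ s} ≤
      #{n ∈ range (#s - 1) | (s.sort (· ≤ ·)).getD (n + 1) 0 = (s.sort (· ≤ ·)).getD n 0 + h} := by
  refine (card_le_card (t := image (fun n => (s.sort (· ≤ ·)).getD n 0) _) ?_).trans card_image_le
  intro x hx
  obtain ⟨hxs, hxh, hxi⟩ := mem_filter.1 hx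
  have hsort := sortedLT_sort s
  have hlen : (s.sort (· ≤ ·)).length = #s := length_sort _
  set l := s.sort (· ≤ ·) with hl
  obtain ⟨i, hi, rfl⟩ := List.getElem_of_mem ((mem_sort (· ≤ ·)).2 hxs)
  obtain ⟨j, hj, hji⟩ := List.getElem_of_mem ((mem_sort (· ≤ ·)).2 hxh)
  have hij : i < j := (hsort.getElem_lt_getElem_iff (hi := hi) (hj := hj)).1 (by
    change l[i] < l[j]
    have : l[j] = l[i] + h := hji
    omega)
  have hj' : j = i + 1 := by
    by_contra hne
    have hi1 : i + 1 < l.length := by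
      have : j < l.length := hj
      omega
    have h1 : l[i] < l[i + 1] := hsort.getElem_lt_getElem_iff.2 (by omega)
    have h2 : l[i + 1] < l[j] := hsort.getElem_lt_getElem_iff.2 (by omega)
    have h3 : l[j] = l[i] + h := hji
    refine hxi (l[i + 1] - l[i]) (mem_Ioo.2 ⟨by omega, by omega⟩) ?_
    have h4 : l[i] + (l[i + 1] - l[i]) = l[i + 1] := by omega
    change l[i] + (l[i + 1] - l[i]) ∈ s
    rw [h4]
    exact (mem_sort (· ≤ ·)).1 (List.getElem_mem hi1)
  subst hj'
  refine mem_image.2 ⟨i, mem_filter.2 ⟨mem_range.2 ?_, ?_⟩, List.getD_eq_getElem _ _ hi⟩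
  · have : i + 1 < l.length := hj
    omega
  · rw [List.getD_eq_getElem _ _ hi, List.getD_eq_getElem _ _ hj]
    exact hji

open Finset in
theorem card_primRoots_Ico {p : ℕ} [Fact p.Prime] :
    #{g ∈ Ico 1 p | orderOf ((g : ℕ) : ZMod p) = p - 1} = (p - 1).totient := by
  have hp := (Fact.out : p.Prime)
  have hp2 := hp.two_le
  have h1 : #{u : (ZMod p)ˣ | orderOf u = p - 1} = (p - 1).totient := by
    apply IsCyclic.card_orderOf_eq_totient
    rw [ZMod.card_units]
  rw [← h1]
  refine card_bij' (fun g _ => if hg : ((g : ℕ) : ZMod p) = 0 then 1 else Units.mk0 (g : ZMod p) hg)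
    (fun u _ => (u : ZMod p).val) ?_ ?_ ?_ ?_
  · intro g hg
    obtain ⟨hg1, hg2⟩ := mem_filter.1 hg
    have hg0 := ((orderOf_eq_pred_iff _).1 hg2).1
    rw [dif_neg hg0, mem_filter, ← orderOf_units]
    exact ⟨mem_univ _, hg2⟩
  · intro u hu
    rw [mem_filter, ZMod.natCast_zmod_val, orderOf_units, mem_Ico]
    refine ⟨⟨Nat.pos_of_ne_zero fun h => u.ne_zero ((ZMod.val_eq_zero _).1 h), ZMod.val_lt _⟩,
      (mem_filter.1 hu).2⟩
  · intro g hg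
    obtain ⟨hg1, hg2⟩ := mem_filter.1 hg
    have hg0 := ((orderOf_eq_pred_iff _).1 hg2).1
    simp only [dif_neg hg0, Units.val_mk0]
    exact ZMod.val_cast_of_lt (mem_Ico.1 hg1).2
  · intro u hu
    ext
    simp

open Finset in
theorem card_primRoot_gap_le {p : ℕ} [Fact p.Prime] {h : ℕ} :
    primRootGapCount p h ≤
      #{x ∈ {g ∈ Ico 1 p | orderOf ((g : ℕ) : ZMod p) = p - 1} |
        x + h ∈ {g ∈ Ico 1 p | orderOf ((g : ℕ) : ZMod p) = p - 1} ∧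
        ∀ i ∈ Ioo 0 h, x + i ∉ {g ∈ Ico 1 p | orderOf ((g : ℕ) : ZMod p) = p - 1}} + h := by
  classical
  rw [primRootGapCount]
  set A := {x ∈ {g ∈ Ico 1 p | orderOf ((g : ℕ) : ZMod p) = p - 1} |
        x + h ∈ {g ∈ Ico 1 p | orderOf ((g : ℕ) : ZMod p) = p - 1} ∧
        ∀ i ∈ Ioo 0 h, x + i ∉ {g ∈ Ico 1 p | orderOf ((g : ℕ) : ZMod p) = p - 1}} with hA
  have hB : #(Ico (p - h) p) ≤ h := by rw [Nat.card_Ico]; omega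
  refine le_trans (le_trans ?_ (card_union_le A (Ico (p - h) p))) (Nat.add_le_add_left hB _)
  refine card_le_card_of_injOn ZMod.val ?_ (ZMod.val_injective p).injOn
  intro x hx
  obtain ⟨⟨h1, h2⟩, h3⟩ : (orderOf x = p - 1 ∧ orderOf (x + h) = p - 1) ∧
      ∀ i ∈ Ioo 0 h, orderOf (x + (i : ℕ)) ≠ p - 1 := by simpa using hx
  have hx0 := ((orderOf_eq_pred_iff _).1 h1).1
  have hxpos : 1 ≤ x.val := Nat.pos_of_ne_zero fun h => hx0 ((ZMod.val_eq_zero _).1 h)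
  have hxlt := ZMod.val_lt x
  rw [mem_coe, mem_union]
  by_cases hxh : x.val + h < p
  · left
    simp only [hA, mem_filter, mem_Ico, Nat.cast_add, ZMod.natCast_zmod_val]
    exact ⟨⟨⟨hxpos, hxlt⟩, h1⟩, ⟨⟨by omega, hxh⟩, h2⟩, fun i hi hc => h3 i hi hc.2⟩
  · right
    rw [mem_Ico]
    omega

open Finset in
theorem sum_card_primRoot_gap_le {p : ℕ} [Fact p.Prime] {r : ℕ} {H : Finset ℕ}
    (h0 : ∀ h ∈ H, 0 < h) (hr : ∀ h ∈ H, h % 2 = r) :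
    ∑ h ∈ H, primRootGapCount p h ≤
      #{n ∈ range ((p - 1).totient - 1) | seqS p n = r} + ∑ h ∈ H, h := by
  set l := primRootsList p with hl
  have hlen := card_primRoots_Ico (p := p)
  calc ∑ h ∈ H, primRootGapCount p h
      ≤ ∑ h ∈ H, (#{n ∈ range ((p - 1).totient - 1) | l.getD (n + 1) 0 = l.getD n 0 + h} + h) := by
        refine sum_le_sum fun h hh => card_primRoot_gap_le.trans ?_
        refine Nat.add_le_add_right ?_ h
        refine (card_consecutive_le_card_sort_gap _ (h0 h hh)).trans ?_
        rw [hlen, hl, primRootsList]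
    _ ≤ _ := by
        rw [sum_add_distrib]
        gcongr
        rw [← card_biUnion]
        · refine card_le_card fun n hn => ?_
          obtain ⟨h, hh, hn⟩ := mem_biUnion.1 hn
          obtain ⟨hn1, hn2⟩ := mem_filter.1 hn
          refine mem_filter.2 ⟨hn1, ?_⟩
          rw [seqS, Nat.mod_eq_of_lt (mem_range.1 hn1), ← hl, hn2]
          have := hr h hh
          omega
        · intro h _ h' _ hne
          rw [Function.onFun, disjoint_left]
          intro n hn hn'
          have := (mem_filter.1 hn).2
          have := (mem_filter.1 hn').2
          omega

open Finset in
theorem le_card_seqS_add {p : ℕ} [Fact p.Prime] {b c J : ℕ} (hb : b ≤ 1) (hc : 2 * c < p)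
    {η : ℝ} (hη0 : 0 ≤ η) (hη : ∀ S : Finset (ZMod p), #S ≤ J + 2 →
      |(#{x : ZMod p | ∀ a ∈ S, orderOf (x + a) = p - 1} : ℝ) - p * primRootDensity p ^ #S| ≤ η) :
    p * primRootDensity p ^ 2 * (1 - primRootDensity p) ^ b *
        ∑ i ∈ range c, ((1 - primRootDensity p) ^ 2) ^ i ≤
      (#{n ∈ range ((p - 1).totient - 1) | seqS p n = (1 + b) % 2} : ℝ) +
        ((2 * c : ℝ) ^ (J + 1) * η +
          2 * (p * primRootDensity p) * ((2 * c * primRootDensity p) ^ (J + 1) / J.factorial) +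
          (2 * c : ℝ) ^ 2) := by
  have hρ0 : 0 ≤ primRootDensity p := by unfold primRootDensity; positivity
  set ρ := primRootDensity p
  have hinj : Function.Injective fun i : ℕ => 2 * i + 1 + b := fun i j h => by
    have : 2 * i + 1 + b = 2 * j + 1 + b := h
    omega
  have key := sum_card_primRoot_gap_le (p := p) (r := (1 + b) % 2)
    (H := (range c).map ⟨_, hinj⟩) (by simp) (by simp; omega)
  simp only [sum_map, Function.Embedding.coeFn_mk] at key
  have hsum : ∑ i ∈ range c, (2 * i + 1 + b) ≤ (2 * c) ^ 2 := by
    calc ∑ i ∈ range c, (2 * i + 1 + b) ≤ ∑ i ∈ range c, 2 * c :=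
          sum_le_sum fun i hi => by have := mem_range.1 hi; omega
      _ = c * (2 * c) := by simp
      _ ≤ (2 * c) ^ 2 := by nlinarith
  have key' : ∑ i ∈ range c, (primRootGapCount p (2 * i + 1 + b) : ℝ) ≤
      #{n ∈ range ((p - 1).totient - 1) | seqS p n = (1 + b) % 2} + (2 * c : ℝ) ^ 2 := by
    exact_mod_cast key.trans (Nat.add_le_add_left hsum _)
  have hterm : ∀ i ∈ range c, p * ρ ^ 2 * (1 - ρ) ^ b * ((1 - ρ) ^ 2) ^ i -
      ((2 * c : ℝ) ^ J * η + 2 * (p * ρ ^ 2) * ((2 * c * ρ) ^ J / J.factorial)) ≤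
      primRootGapCount p (2 * i + 1 + b) := by
    intro i hi
    have hi := mem_range.1 hi
    have h1 := (abs_le.1 (abs_card_primRoot_gap_sub_le (h := 2 * i + 1 + b) (by omega) (by omega)
      hη0 hη)).1
    have h2 : ((2 * i + 1 + b : ℕ) : ℝ) ≤ 2 * c := by
      exact_mod_cast (show 2 * i + 1 + b ≤ 2 * c by omega)
    have h3 : ((2 * i + 1 + b : ℕ) : ℝ) ^ J * η +
        2 * (p * ρ ^ 2) * ((((2 * i + 1 + b : ℕ) : ℝ) * ρ) ^ J / J.factorial) ≤
        (2 * c : ℝ) ^ J * η + 2 * (p * ρ ^ 2) * ((2 * c * ρ) ^ J / J.factorial) := by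
      gcongr
    have h4 : (1 - ρ) ^ (2 * i + 1 + b - 1) = (1 - ρ) ^ b * ((1 - ρ) ^ 2) ^ i := by
      rw [← pow_mul, ← pow_add]
      congr 1
      omega
    rw [h4, ← mul_assoc] at h1
    linarith
  have hs := sum_le_sum hterm
  rw [sum_sub_distrib, ← mul_sum, sum_const, card_range, nsmul_eq_mul] at hs
  have hE0 : 0 ≤ (2 * c : ℝ) ^ J * η + 2 * (p * ρ ^ 2) * ((2 * c * ρ) ^ J / J.factorial) := by
    positivity
  have hE : c * ((2 * c : ℝ) ^ J * η + 2 * (p * ρ ^ 2) * ((2 * c * ρ) ^ J / J.factorial)) ≤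
      (2 * c : ℝ) ^ (J + 1) * η + 2 * (p * ρ) * ((2 * c * ρ) ^ (J + 1) / J.factorial) := by
    calc _ ≤ 2 * c * ((2 * c : ℝ) ^ J * η + 2 * (p * ρ ^ 2) * ((2 * c * ρ) ^ J / J.factorial)) := by
          have : (0 : ℝ) ≤ c := Nat.cast_nonneg c
          gcongr
          linarith
      _ = _ := by ring
  linarith

open Finset in
theorem div_sub_le_mul_geom_sum {ρ : ℝ} (h0 : 0 < ρ) (h1 : ρ ≤ 1) (c : ℕ) :
    ρ / (2 - ρ) - ρ * (1 - ρ) ^ (2 * c) ≤ ρ ^ 2 * ∑ i ∈ range c, ((1 - ρ) ^ 2) ^ i := by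
  have h2 : 0 < 2 - ρ := by linarith
  have hg := geom_sum_mul_neg ((1 - ρ) ^ 2) c
  rw [← pow_mul] at hg
  have hq : 0 ≤ (1 - ρ) ^ (2 * c) := pow_nonneg (by linarith) _
  have e : ρ ^ 2 * ∑ i ∈ range c, ((1 - ρ) ^ 2) ^ i = ρ * (1 - (1 - ρ) ^ (2 * c)) / (2 - ρ) := by
    rw [eq_div_iff h2.ne', ← hg]
    ring
  rw [e, mul_sub, mul_one, sub_div]
  gcongr
  exact div_le_self (by positivity) (by linarith)

theorem one_sub_pow_le_exp_neg {ρ x : ℝ} (h1 : ρ ≤ 1) {n : ℕ} (hx : x ≤ n * ρ) :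
    (1 - ρ) ^ n ≤ Real.exp (-x) := by
  calc (1 - ρ) ^ n ≤ Real.exp (-ρ) ^ n := by
        exact pow_le_pow_left₀ (by linarith) (Real.one_sub_le_exp_neg ρ) n
    _ = Real.exp (-(n * ρ)) := by rw [← Real.exp_nat_mul]; ring_nf
    _ ≤ _ := by gcongr

open Finset in
/-- Each parity occurs among the gaps of consecutive primitive roots at least as often as the
geometric model predicts, up to a negligible error. -/
theorem exists_forall_le_card_seqS {δ : ℝ} (hδ : 0 < δ) :
    ∃ P : ℕ, ∀ (p : ℕ) [Fact p.Prime], P ≤ p → ∀ b ≤ 1,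
      p * primRootDensity p * ((1 - primRootDensity p) ^ b / (2 - primRootDensity p) - δ) ≤
        #{n ∈ range ((p - 1).totient - 1) | seqS p n = (1 + b) % 2} := by
  obtain ⟨m, hm⟩ : ∃ m : ℕ, Real.exp (-m) ≤ δ / 4 :=
    ((Real.tendsto_exp_neg_atTop_nhds_zero.comp tendsto_natCast_atTop_atTop).eventually_le_const
      (by positivity)).exists
  set Λ : ℝ := 2 * (m + 1) with hΛ
  have hΛ0 : 0 < Λ := by positivity
  obtain ⟨J, hJ⟩ : ∃ J : ℕ, Λ ^ J / J.factorial ≤ δ / (8 * Λ) :=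
    ((FloorSemiring.tendsto_pow_div_factorial_atTop Λ).eventually_le_const
      (by positivity)).exists
  obtain ⟨P₀, hP₀⟩ := exists_forall_abs_card_primRoots_sub_le (J + 2) (J + 3)
  obtain ⟨K, hK⟩ := exists_nat_ge (32 * Λ ^ 2 / δ + Λ)
  obtain ⟨t₀, ht₀⟩ := exists_forall_poly_mul_pow_le_two_pow K 0
  obtain ⟨N₁, hN₁⟩ := exists_nat_ge (8 * (2 * Λ) ^ (J + 1) / δ)
  refine ⟨P₀ + 2 ^ (t₀ + N₁ + 1), fun p _ hp b hb => ?_⟩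
  have hp2 := (Fact.out : p.Prime).two_le
  have hη := hP₀ p (le_of_add_le_left hp)
  have hρN := inv_log_add_one_le_primRootDensity hp2
  have hN := Nat.log_mono_right (b := 2) (le_of_add_le_right hp)
  rw [Nat.log_pow one_lt_two] at hN
  have hNp : 2 ^ Nat.log 2 p ≤ p := Nat.pow_log_le_self 2 (by omega)
  set N := Nat.log 2 p
  have hρ1 := primRootDensity_le_one p
  set ρ := primRootDensity p
  have hρ0 : 0 < ρ := lt_of_lt_of_le (by positivity) hρN
  have hN1 : (1 : ℝ) ≤ N := by exact_mod_cast (show 1 ≤ N by omega)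
  have hρN' : 1 ≤ 2 * N * ρ := by
    rw [div_le_iff₀ (by positivity)] at hρN
    nlinarith
  have hpoly : 32 * Λ ^ 2 / δ * N ^ 3 + 2 * Λ * N < p := by
    have h1 : ((2 * K * (N + 1) ^ 8 + 4) * (N + 1) ^ 0 : ℝ) ≤ p := by
      exact_mod_cast (ht₀ N (by omega)).trans hNp
    have h2 : (N : ℝ) ^ 3 ≤ (N + 1) ^ 8 :=
      (pow_le_pow_right₀ hN1 (show 3 ≤ 8 by norm_num)).trans (by gcongr; linarith)
    have h3 : (N : ℝ) ≤ (N + 1) ^ 8 := by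
      calc (N : ℝ) = N ^ 1 := (pow_one _).symm
        _ ≤ N ^ 8 := pow_le_pow_right₀ hN1 (by norm_num)
        _ ≤ _ := by gcongr; linarith
    have h4 : 32 * Λ ^ 2 / δ * N ^ 3 ≤ 32 * Λ ^ 2 / δ * (N + 1) ^ 8 := by gcongr
    have h5 : Λ * N ≤ Λ * (N + 1) ^ 8 := by gcongr
    have h6 : (32 * Λ ^ 2 / δ + Λ) * (N + 1 : ℝ) ^ 8 ≤ K * (N + 1) ^ 8 := by gcongr
    have h7 : 0 ≤ 32 * Λ ^ 2 / δ * (N + 1 : ℝ) ^ 8 := by positivity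
    linarith
  obtain ⟨c, hc1, hc2⟩ : ∃ c : ℕ, m ≤ c * ρ ∧ 2 * c * ρ ≤ Λ := by
    refine ⟨⌈m / ρ⌉₊, (div_le_iff₀ hρ0).1 (Nat.le_ceil _), ?_⟩
    have := (Nat.ceil_lt_add_one (a := m / ρ) (by positivity)).le
    calc 2 * (⌈m / ρ⌉₊ : ℝ) * ρ ≤ 2 * (m / ρ + 1) * ρ := by gcongr
      _ = 2 * (m + ρ) := by field_simp
      _ ≤ Λ := by rw [hΛ]; gcongr
  have hc3 : 2 * (c : ℝ) ≤ 2 * Λ * N := by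
    calc 2 * (c : ℝ) ≤ 2 * c * (2 * N * ρ) := le_mul_of_one_le_right (by positivity) hρN'
      _ = 2 * N * (2 * c * ρ) := by ring
      _ ≤ 2 * N * Λ := by gcongr
      _ = _ := by ring
  have hcp : 2 * c < p := by
    have : 0 ≤ 32 * Λ ^ 2 / δ * (N : ℝ) ^ 3 := by positivity
    exact_mod_cast (show 2 * (c : ℝ) < p by linarith)
  have main := le_card_seqS_add (J := J) hb hcp (by positivity) hη
  have hgeom := div_sub_le_mul_geom_sum hρ0 hρ1 c
  have hexp : (1 - ρ) ^ (2 * c) ≤ δ / 4 :=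
    (one_sub_pow_le_exp_neg hρ1 (by push_cast; nlinarith)).trans hm
  have hE1 : (2 * c : ℝ) ^ (J + 1) * (p / N ^ (J + 3)) ≤ δ / 4 * (p * ρ) := by
    calc (2 * c : ℝ) ^ (J + 1) * (p / N ^ (J + 3))
        ≤ (2 * Λ * N) ^ (J + 1) * (p / N ^ (J + 3)) := by gcongr
      _ = (2 * Λ) ^ (J + 1) * p / N ^ 2 := by
        rw [mul_pow]
        field_simp
        ring
      _ ≤ δ / 8 * N * p / N ^ 2 := by
        have h1 : (N₁ : ℝ) ≤ N := by exact_mod_cast (show N₁ ≤ N by omega)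
        have h2 := (div_le_iff₀ hδ).1 (hN₁.trans h1)
        gcongr
        linarith
      _ = δ / 4 * (p * (1 / (2 * N))) := by field_simp; ring
      _ ≤ _ := by
        gcongr
        rw [div_le_iff₀ (by positivity)]
        linarith
  have hE2 : 2 * (p * ρ) * ((2 * c * ρ) ^ (J + 1) / J.factorial) ≤ δ / 4 * (p * ρ) := by
    calc 2 * (p * ρ) * ((2 * c * ρ) ^ (J + 1) / J.factorial)
        ≤ 2 * (p * ρ) * (Λ ^ (J + 1) / J.factorial) := by gcongr
      _ = 2 * (p * ρ) * (Λ * (Λ ^ J / J.factorial)) := by ring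
      _ ≤ 2 * (p * ρ) * (Λ * (δ / (8 * Λ))) := by gcongr
      _ = _ := by field_simp; ring
  have hE3 : (2 * c : ℝ) ^ 2 ≤ δ / 4 * (p * ρ) := by
    calc (2 * c : ℝ) ^ 2 ≤ (2 * Λ * N) ^ 2 := by gcongr
      _ = δ / 4 * (32 * Λ ^ 2 / δ * N ^ 3 * (1 / (2 * N))) := by field_simp; ring
      _ ≤ _ := by
        gcongr
        · nlinarith
        · rw [div_le_iff₀ (by positivity)]
          linarith
  have hb1 : (1 - ρ) ^ b ≤ 1 := pow_le_one₀ (by linarith) (by linarith)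
  have hb0 : 0 ≤ (1 - ρ) ^ b := pow_nonneg (by linarith) _
  have hmain : p * ρ * ((1 - ρ) ^ b / (2 - ρ)) - p * ρ * (δ / 4) ≤
      p * ρ ^ 2 * (1 - ρ) ^ b * ∑ i ∈ range c, ((1 - ρ) ^ 2) ^ i := by
    have h1 : (1 - ρ) ^ b * (1 - ρ) ^ (2 * c) ≤ δ / 4 :=
      (mul_le_of_le_one_left (pow_nonneg (by linarith) _) hb1).trans hexp
    calc p * ρ * ((1 - ρ) ^ b / (2 - ρ)) - p * ρ * (δ / 4)
        ≤ p * ρ * ((1 - ρ) ^ b / (2 - ρ)) - p * ρ * ((1 - ρ) ^ b * (1 - ρ) ^ (2 * c)) := by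
          gcongr
      _ = p * (1 - ρ) ^ b * (ρ / (2 - ρ) - ρ * (1 - ρ) ^ (2 * c)) := by ring
      _ ≤ p * (1 - ρ) ^ b * (ρ ^ 2 * ∑ i ∈ range c, ((1 - ρ) ^ 2) ^ i) := by gcongr
      _ = _ := by ring
  linarith

theorem exists_forall_le_mul_primRootDensity (A : ℝ) :
    ∃ P : ℕ, ∀ p ≥ P, A ≤ p * primRootDensity p := by
  obtain ⟨K, hK⟩ := exists_nat_ge A
  obtain ⟨t₀, ht₀⟩ := exists_forall_poly_mul_pow_le_two_pow K 1
  refine ⟨2 ^ (t₀ + 1), fun p hp => ?_⟩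
  have hN := Nat.log_mono_right (b := 2) hp
  rw [Nat.log_pow one_lt_two] at hN
  have hp2 : 2 ≤ p := le_trans (by rw [pow_succ]; have := Nat.one_le_two_pow (n := t₀); omega) hp
  have h1 := (ht₀ (Nat.log 2 p) (by omega)).trans (Nat.pow_log_le_self 2 (by omega))
  have h2 := inv_log_add_one_le_primRootDensity hp2
  have h3 : K * (Nat.log 2 p + 1) ≤ p := by
    refine le_trans ?_ h1
    rw [pow_one]
    gcongr
    have := Nat.one_le_pow 8 (Nat.log 2 p + 1) (by omega)
    nlinarith
  have h3' : (K * (Nat.log 2 p + 1) : ℝ) ≤ p := by exact_mod_cast h3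
  calc A ≤ K := hK
    _ ≤ p * (1 / (Nat.log 2 p + 1)) := by
      rw [mul_one_div, le_div_iff₀ (by positivity)]
      exact h3'
    _ ≤ _ := by gcongr

open Finset in
theorem exists_forall_abs_card_seqS_sub_le {δ : ℝ} (hδ : 0 < δ) :
    ∃ P : ℕ, ∀ p : ℕ, p.Prime → P ≤ p →
      |(#{n ∈ range ((p - 1).totient - 1) | seqS p n = 1} : ℝ) -
        p * primRootDensity p / (2 - primRootDensity p)| ≤ δ * (p * primRootDensity p) := by
  obtain ⟨P, hP⟩ := exists_forall_le_card_seqS hδ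
  refine ⟨P, fun p hp hPp => ?_⟩
  have : Fact p.Prime := ⟨hp⟩
  have hp2 := hp.two_le
  have h1 := hP p hPp 0 zero_le_one
  have h0 := hP p hPp 1 le_rfl
  norm_num at h0 h1
  have hρ1 := primRootDensity_le_one p
  have hφ : ((p - 1).totient : ℝ) ≤ p * primRootDensity p := by
    have hp' : (0 : ℝ) < (p - 1 : ℕ) := by exact_mod_cast (show 0 < p - 1 by omega)
    rw [primRootDensity, ← mul_div_assoc, le_div_iff₀ hp', mul_comm]
    gcongr
    exact Nat.sub_le p 1
  have hadd : #{n ∈ range ((p - 1).totient - 1) | seqS p n = 0} +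
      #{n ∈ range ((p - 1).totient - 1) | seqS p n = 1} = (p - 1).totient - 1 := by
    have := card_filter_add_card_filter_not (s := range ((p - 1).totient - 1))
      (fun n => seqS p n = 0)
    rw [card_range] at this
    rwa [filter_congr fun n _ => (show ¬seqS p n = 0 ↔ seqS p n = 1 by unfold seqS; omega)]
      at this
  have hadd' : (#{n ∈ range ((p - 1).totient - 1) | seqS p n = 0} : ℝ) +
      #{n ∈ range ((p - 1).totient - 1) | seqS p n = 1} ≤ p * primRootDensity p := by
    refine le_trans ?_ hφ
    exact_mod_cast hadd.le.trans (Nat.sub_le _ _)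
  set ρ := primRootDensity p
  have h2 : 2 - ρ ≠ 0 := by linarith
  have e1 : p * ρ * ((2 - ρ)⁻¹ - δ) = p * ρ / (2 - ρ) - δ * (p * ρ) := by ring
  have e0 : p * ρ * ((1 - ρ) / (2 - ρ) - δ) = p * ρ - p * ρ / (2 - ρ) - δ * (p * ρ) := by
    field_simp
    ring
  rw [abs_le]
  constructor <;> linarith

/-- `N(1) = (1/(2 - φ(p-1)/p) + o(1)) T` as `p → ∞` through the primes. -/
theorem count_ones_asymptotic :
    ∀ ε : ℝ, 0 < ε → ∃ P : ℕ, ∀ p : ℕ, Nat.Prime p → P ≤ p →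
      |((((Finset.range (Nat.totient (p - 1) - 1)).filter fun n => seqS p n = 1).card : ℝ) -
          ((Nat.totient (p - 1) - 1 : ℕ) : ℝ) /
            (2 - (Nat.totient (p - 1) : ℝ) / (p : ℝ)))| ≤
        ε * ((Nat.totient (p - 1) - 1 : ℕ) : ℝ) := by
  intro ε hε
  obtain ⟨P₁, hP₁⟩ := exists_forall_abs_card_seqS_sub_le (half_pos hε)
  obtain ⟨P₂, hP₂⟩ := exists_forall_le_mul_primRootDensity (4 + 6 / ε)
  refine ⟨P₁ + P₂, fun p hp hPp => ?_⟩
  have h1 := hP₁ p hp (le_of_add_le_left hPp)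
  have h2 := hP₂ p (le_of_add_le_right hPp)
  have hp2 := hp.two_le
  have hρ1 := primRootDensity_le_one p
  have hφ1 : 1 ≤ (p - 1).totient := Nat.totient_pos.2 (by omega)
  have hp0 : (0 : ℝ) < p := by exact_mod_cast (show 0 < p by omega)
  have hφ : ((p - 1).totient : ℝ) = p * primRootDensity p - primRootDensity p := by
    have hp' : (0 : ℝ) < (p - 1 : ℕ) := by exact_mod_cast (show 0 < p - 1 by omega)
    have hp1 : ((p - 1 : ℕ) : ℝ) = p - 1 := by rw [Nat.cast_sub (by omega), Nat.cast_one]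
    rw [← sub_one_mul, ← hp1, primRootDensity]
    field_simp
  have hρ0 : 0 ≤ primRootDensity p := by unfold primRootDensity; positivity
  rw [Nat.cast_sub hφ1, Nat.cast_one, hφ]
  set ρ := primRootDensity p
  have ha : (p * ρ - ρ) / p = ρ - ρ / p := by field_simp
  rw [ha]
  set a := 2 - (ρ - ρ / p) with ha_def
  have hρp : 0 ≤ ρ / p := by positivity
  have ha1 : 2 - ρ ≤ a := by linarith
  have hT : 0 ≤ p * ρ - ρ - 1 := by
    have : 0 < 6 / ε := by positivity
    linarith
  have hup : (p * ρ - ρ - 1) / a ≤ p * ρ / (2 - ρ) := by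
    gcongr
    · linarith
    · linarith
  have hlo : p * ρ / (2 - ρ) - 3 ≤ (p * ρ - ρ - 1) / a := by
    have ha0 : 1 ≤ a := by linarith
    have h3 : (ρ + 1) / a ≤ 2 := (div_le_self (by linarith) ha0).trans (by linarith)
    have h4 : p * ρ / (2 - ρ) - p * ρ / a ≤ 1 := by
      rw [div_sub_div _ _ (by linarith) (by linarith)]
      have e : p * ρ * a - (2 - ρ) * (p * ρ) = ρ * ρ := by
        rw [ha_def]
        field_simp
        ring
      rw [e]
      refine div_le_one_of_le₀ ?_ (by nlinarith)
      nlinarith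
    have h5 : (p * ρ - ρ - 1) / a = p * ρ / a - (ρ + 1) / a := by ring
    linarith
  have hε' : ε / 2 * (p * ρ) + 3 ≤ ε * (p * ρ - ρ - 1) := by
    have h6 : ε * (4 + 6 / ε) ≤ ε * (p * ρ) := by gcongr
    have h7 : ε * (4 + 6 / ε) = 4 * ε + 6 := by field_simp
    nlinarith
  rw [abs_le] at h1 ⊢
  constructor <;> linarith
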